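/- For a commutative semigroup variety V, the following conditions are equivalent: (a) V is an upper-modular element of the lattice Com; (b) V is a codistributive element of the lattice Com; (c) one of the following holds: (i) V = COM; (ii) V = M ∨ N where M is one of the varieties T or SL and N is a commutative semigroup variety satisfying the identities x²yz = 0 and x²y = xy²; (iii) V = G ∨ M ∨ N where G is an Abelian periodic group variety, M is one of the varieties T, SL or C₂, and N is a commutative semigroup variety satisfying the identity x²y = 0. -/

import Mathlib

/-!
Formalization framework: semigroup varieties as Galois-closed equational theories
over the free semigroup on countably many letters.  A variety is represented by
its equational theory; the order `V ≤ W` ("V is a subvariety of W") is reverse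
inclusion of theories.  `Com` is the lattice of commutative semigroup varieties,
realized as the subtype of varieties whose theory contains the commutative law.
-/

open FreeSemigroup

/-- Words: elements of the free semigroup over a countably infinite alphabet. -/
abbrev Word : Type := FreeSemigroup ℕ

/-- A semigroup identity `u = v`. -/
abbrev SgId : Type := Word × Word

/-- `spow a n = a ^ (n + 1)` in any (multiplicative) semigroup. -/
def spow {M : Type*} [Mul M] (a : M) : ℕ → M
  | 0 => a
  | n + 1 => a * spow a n

/-- A semigroup `S` satisfies the identity `e.1 = e.2`. -/
def SatS (S : Type) [Semigroup S] (e : SgId) : Prop :=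
  ∀ σ : ℕ → S, FreeSemigroup.lift σ e.1 = FreeSemigroup.lift σ e.2

/-- `S` is a model of the set of identities `E`. -/
def Models (S : Type) [Semigroup S] (E : Set SgId) : Prop :=
  ∀ e ∈ E, SatS S e

/-- The equational theory generated by `E`: all identities holding in every
model of `E` (by Birkhoff's theorem this is exactly deductive closure). -/
def eqTh (E : Set SgId) : Set SgId :=
  { e | ∀ (S : Type) [Semigroup S], Models S E → SatS S e }

theorem subset_eqTh (E : Set SgId) : E ⊆ eqTh E := by
  intro e he S _ hS
  exact hS e he

theorem eqTh_mono {E F : Set SgId} (h : E ⊆ F) : eqTh E ⊆ eqTh F := by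
  intro e he S _ hS
  exact he S fun e' he' => hS e' (h he')

theorem eqTh_idem (E : Set SgId) : eqTh (eqTh E) = eqTh E := by
  refine Set.Subset.antisymm ?_ (subset_eqTh _)
  intro e he S _ hS
  exact he S fun e' he' => he' S hS

/-- A semigroup variety, given by its (Galois-closed) equational theory. -/
structure SgVariety where
  th : Set SgId
  closed : eqTh th = th

theorem SgVariety.ext' {V W : SgVariety} (h : V.th = W.th) : V = W := by
  cases V; cases W; cases h; rfl

/-- The variety defined by a set of identities. -/
def varOf (E : Set SgId) : SgVariety :=
  ⟨eqTh E, eqTh_idem E⟩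

/-- `V ≤ W` iff `V` is a subvariety of `W`, i.e. the theory of `W` is contained
in the theory of `V`. -/
instance : PartialOrder SgVariety where
  le V W := W.th ⊆ V.th
  le_refl V := Set.Subset.refl _
  le_trans a b c h1 h2 := Set.Subset.trans h2 h1
  le_antisymm a b h1 h2 := SgVariety.ext' (Set.Subset.antisymm h2 h1)

/-- The lattice **SEM** of all semigroup varieties: join is intersection of
theories; meet is the variety defined by the union of the theories. -/
instance : Lattice SgVariety :=
  { (inferInstance : PartialOrder SgVariety) with
    sup := fun V W =>
      ⟨V.th ∩ W.th, by
        refine Set.Subset.antisymm (Set.subset_inter ?_ ?_) (subset_eqTh _)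
        · exact (eqTh_mono Set.inter_subset_left).trans (le_of_eq V.closed)
        · exact (eqTh_mono Set.inter_subset_right).trans (le_of_eq W.closed)⟩
    le_sup_left := fun V W => Set.inter_subset_left
    le_sup_right := fun V W => Set.inter_subset_right
    sup_le := fun V W U h1 h2 => Set.subset_inter h1 h2
    inf := fun V W => varOf (V.th ∪ W.th)
    inf_le_left := fun V W => Set.subset_union_left.trans (subset_eqTh _)
    inf_le_right := fun V W => Set.subset_union_right.trans (subset_eqTh _)
    le_inf := fun U V W h1 h2 =>
      (eqTh_mono (Set.union_subset h1 h2)).trans (le_of_eq U.closed) }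

/-- The letters `x`, `y`, `z`. -/
def xw : Word := FreeSemigroup.of 0
def yw : Word := FreeSemigroup.of 1
def zw : Word := FreeSemigroup.of 2

/-- The commutative law `xy = yx`. -/
def commId : SgId := (xw * yw, yw * xw)

/-- The lattice **Com**: commutative semigroup varieties. -/
abbrev ComVariety : Type := { V : SgVariety // commId ∈ V.th }

instance : Lattice ComVariety :=
  { (inferInstance : PartialOrder ComVariety) with
    sup := fun V W => ⟨V.1 ⊔ W.1, ⟨V.2, W.2⟩⟩
    le_sup_left := fun V W => @le_sup_left SgVariety _ V.1 W.1
    le_sup_right := fun V W => @le_sup_right SgVariety _ V.1 W.1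
    sup_le := fun V W U h1 h2 => @sup_le SgVariety _ V.1 W.1 U.1 h1 h2
    inf := fun V W => ⟨V.1 ⊓ W.1, subset_eqTh _ (Set.mem_union_left _ V.2)⟩
    inf_le_left := fun V W => @inf_le_left SgVariety _ V.1 W.1
    inf_le_right := fun V W => @inf_le_right SgVariety _ V.1 W.1
    le_inf := fun U V W h1 h2 => @le_inf SgVariety _ U.1 V.1 W.1 h1 h2 }

/-- The trivial variety `T`. -/
def trivialVar : SgVariety := varOf Set.univ

/-- The variety `COM` of all commutative semigroups. -/
def COMvar : SgVariety := varOf {commId}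

/-- The variety `SL` of semilattices. -/
def SLvar : SgVariety := varOf {commId, (xw * xw, xw)}

/-- `C_m = var{xᵐ = xᵐ⁺¹, xy = yx}` for `m ≥ 1`, and `C_0 = T`. -/
def Cvar : ℕ → SgVariety
  | 0 => trivialVar
  | m + 1 => varOf {commId, (spow xw m, spow xw (m + 1))}

def Tcom : ComVariety := ⟨trivialVar, subset_eqTh _ (Set.mem_univ _)⟩
def COMcom : ComVariety := ⟨COMvar, subset_eqTh _ rfl⟩
def SLcom : ComVariety := ⟨SLvar, subset_eqTh _ (Set.mem_insert _ _)⟩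
def Ccom (m : ℕ) : ComVariety :=
  ⟨Cvar m, by
    cases m with
    | zero => exact subset_eqTh _ (Set.mem_univ _)
    | succ m => exact subset_eqTh _ (Set.mem_insert _ _)⟩

/-- A semigroup (nonempty, with the given multiplication) is a group. -/
def IsGroupS (S : Type) [Semigroup S] : Prop :=
  ∃ e : S, (∀ a : S, e * a = a ∧ a * e = a) ∧ ∀ a : S, ∃ b : S, a * b = e ∧ b * a = e

/-- A nilsemigroup: there is a zero element and some power of every element is zero. -/
def IsNilS (S : Type) [Semigroup S] : Prop :=
  ∃ z : S, (∀ a : S, z * a = z ∧ a * z = z) ∧ ∀ a : S, ∃ n : ℕ, spow a n = z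

/-- A group variety: all its (nonempty) members are groups. -/
def IsGroupVariety (V : SgVariety) : Prop :=
  ∀ (S : Type) [Semigroup S], Nonempty S → Models S V.th → IsGroupS S

/-- A nil-variety: all its (nonempty) members are nilsemigroups. -/
def IsNilVariety (V : SgVariety) : Prop :=
  ∀ (S : Type) [Semigroup S], Nonempty S → Models S V.th → IsNilS S

/-- A combinatorial variety: all groups in it are singletons. -/
def IsCombinatorial (V : SgVariety) : Prop :=
  ∀ (S : Type) [Semigroup S], Models S V.th → IsGroupS S → Subsingleton S

/-- A periodic variety: satisfies `xⁿ = xⁿ⁺ᵏ` for some `n, k ≥ 1`. -/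
def IsPeriodic (V : SgVariety) : Prop :=
  ∃ n k : ℕ, (spow xw n, spow xw (n + k + 1)) ∈ V.th

/-- The letter `k` occurs in the word `w`. -/
def occursIn (k : ℕ) (w : Word) : Prop := k = w.head ∨ k ∈ w.tail

/-- `S` satisfies the identity `w = 0` (i.e. the system `wx = xw = w`, `x` fresh):
every value of `w` in `S` is a (two-sided) zero element. -/
def SatZeroS (S : Type) [Semigroup S] (w : Word) : Prop :=
  ∀ (σ : ℕ → S) (a : S),
    FreeSemigroup.lift σ w * a = FreeSemigroup.lift σ w ∧
      a * FreeSemigroup.lift σ w = FreeSemigroup.lift σ w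

/-- The variety `V` satisfies the identity `w = 0`. -/
def VSatZero (V : SgVariety) (w : Word) : Prop :=
  ∀ (S : Type) [Semigroup S], Models S V.th → SatZeroS S w

/-- The words `x²`, `x³`, `x²y`, `xy²`, `x²yz`. -/
def w_xx : Word := xw * xw
def w_xxx : Word := xw * xw * xw
def w_xxy : Word := xw * xw * yw
def w_xyy : Word := xw * yw * yw
def w_xxyz : Word := xw * xw * yw * zw

/-- The identity `x²y = xy²`. -/
def idQ : SgId := (w_xxy, w_xyy)

/-- The pair of identities expressing `w = 0`, with `k` a fresh letter. -/
def zeroPair (w : Word) (k : ℕ) : Set SgId :=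
  {(w * FreeSemigroup.of k, w), (FreeSemigroup.of k * w, w)}

/-- `xprodTo n = x₁x₂⋯xₙ` (for `n ≥ 1`), on the letters `0, …, n-1`. -/
def xprodTo : ℕ → Word
  | 0 => FreeSemigroup.of 0
  | 1 => FreeSemigroup.of 0
  | n + 2 => xprodTo (n + 1) * FreeSemigroup.of (n + 1)

/-- `I = var{x²y = xy², x²yz = 0, xy = yx}`. -/
def Ivar : SgVariety := varOf ({commId, idQ} ∪ zeroPair w_xxyz 3)

/-- `K = var{x²y = 0, xy = yx}`. -/
def Kvar : SgVariety := varOf ({commId} ∪ zeroPair w_xxy 2)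

/-- `L = var{x² = 0, xy = yx}`. -/
def Lvar : SgVariety := varOf ({commId} ∪ zeroPair w_xx 1)

/-- `I_n = var{x²yz = x₁⋯xₙ = 0, x²y = xy², xy = yx}`. -/
def Ivarn (n : ℕ) : SgVariety :=
  varOf ({commId, idQ} ∪ zeroPair w_xxyz 3 ∪ zeroPair (xprodTo n) n)

/-- `J = var{x²yz = x³ = 0, x²y = xy², xy = yx}`. -/
def Jvar : SgVariety := varOf ({commId, idQ} ∪ zeroPair w_xxyz 3 ∪ zeroPair w_xxx 1)

/-- `J_n = var{x²yz = x³ = x₁⋯xₙ = 0, x²y = xy², xy = yx}`. -/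
def Jvarn (n : ℕ) : SgVariety :=
  varOf ({commId, idQ} ∪ zeroPair w_xxyz 3 ∪ zeroPair w_xxx 1 ∪ zeroPair (xprodTo n) n)

/-- `K_n = var{x²y = x₁⋯xₙ = 0, xy = yx}`. -/
def Kvarn (n : ℕ) : SgVariety :=
  varOf ({commId} ∪ zeroPair w_xxy 2 ∪ zeroPair (xprodTo n) n)

/-- `L_n = var{x² = x₁⋯xₙ = 0, xy = yx}`. -/
def Lvarn (n : ℕ) : SgVariety :=
  varOf ({commId} ∪ zeroPair w_xx 1 ∪ zeroPair (xprodTo n) n)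

/-- Generators of `ZR(U)`: the commutative law together with all 0-reduced
identities (in the form of the corresponding identity pairs) holding in `U`. -/
def ZRgen (U : SgVariety) : Set SgId :=
  {commId} ∪ { e : SgId | ∃ (w : Word) (k : ℕ), ¬ occursIn k w ∧ VSatZero U w ∧
      (e = (w * FreeSemigroup.of k, w) ∨ e = (FreeSemigroup.of k * w, w)) }

/-- `ZR(U)`: the variety given by the commutative law and all 0-reduced
identities holding in `U`. -/
def ZRvar (U : SgVariety) : SgVariety := varOf (ZRgen U)

def Icom : ComVariety := ⟨Ivar, subset_eqTh _ (Set.mem_union_left _ (Set.mem_insert _ _))⟩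

def ZRcom (U : SgVariety) : ComVariety :=
  ⟨ZRvar U, subset_eqTh _ (Set.mem_union_left _ rfl)⟩

/-- All nilsemigroups in `V` are nilpotent of degree ≤ n, i.e. satisfy `x₁⋯xₙ = 0`. -/
def HasDegLe (V : SgVariety) (n : ℕ) : Prop :=
  ∀ (S : Type) [Semigroup S], Nonempty S → Models S V.th → IsNilS S → SatZeroS S (xprodTo n)

/-- `deg V = d` (with `d = ⊤` meaning infinite degree). -/
def DegIs (V : SgVariety) (d : ℕ∞) : Prop :=
  (∃ n : ℕ, 0 < n ∧ d = (n : ℕ∞) ∧ IsLeast {m : ℕ | 0 < m ∧ HasDegLe V m} n) ∨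
    (d = ⊤ ∧ ∀ n : ℕ, 0 < n → ¬ HasDegLe V n)

/-- Upper-modular element of a lattice. -/
def IsUpperModular {L : Type*} [Lattice L] (a : L) : Prop :=
  ∀ b c : L, b ≤ a → a ⊓ (b ⊔ c) = b ⊔ (a ⊓ c)

/-- Codistributive element of a lattice. -/
def IsCodistributive {L : Type*} [Lattice L] (a : L) : Prop :=
  ∀ b c : L, a ⊓ (b ⊔ c) = (a ⊓ b) ⊔ (a ⊓ c)

/-- Costandard element of a lattice. -/
def IsCostandard {L : Type*} [Lattice L] (a : L) : Prop :=
  ∀ b c : L, (a ⊓ b) ⊔ c = (a ⊔ c) ⊓ (b ⊔ c)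

/-- Modular element of a lattice. -/
def IsModularElt {L : Type*} [Lattice L] (a : L) : Prop :=
  ∀ b c : L, b ≤ c → (a ⊔ b) ⊓ c = (a ⊓ c) ⊔ b

/-- Neutral element of a lattice, via the median characterization
(equivalent to: every triple containing `a` generates a distributive
sublattice; Grätzer, "Lattice Theory: Foundation", Theorem 254). -/
def IsNeutralElt {L : Type*} [Lattice L] (a : L) : Prop :=
  ∀ b c : L, (a ⊓ b) ⊔ (b ⊓ c) ⊔ (c ⊓ a) = (a ⊔ b) ⊓ (b ⊔ c) ⊓ (c ⊔ a)

open Multiset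

/-- A fully invariant congruence on commutative words, written as finite multisets of letters. -/
structure FullyInvariant (R : Multiset ℕ → Multiset ℕ → Prop) : Prop where
  refl : ∀ a, R a a
  symm : ∀ {a b}, R a b → R b a
  trans : ∀ {a b c}, R a b → R b c → R a c
  add_right : ∀ {a b} c, R a b → R (a + c) (b + c)
  bind : ∀ {a b} (φ : ℕ → Multiset ℕ), (∀ i, φ i ≠ 0) → R a b → R (a.bind φ) (b.bind φ)

/-- The word `a` absorbs the word `d` modulo `R`: the identity `a = ad` holds. -/
def WordAbsorbs (R : Multiset ℕ → Multiset ℕ → Prop) (a d : Multiset ℕ) : Prop := R a (a + d)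

namespace Multiset

theorem nsmul_bind' {α β : Type*} (n : ℕ) (a : Multiset α) (f : α → Multiset β) :
    (n • a).bind f = n • a.bind f := by
  induction n with
  | zero => simp
  | succ n ih => simp [succ_nsmul, ih]

theorem bind_ite_eq (a : Multiset ℕ) (i : ℕ) (p q : Multiset ℕ) :
    (a.bind fun j => if j = i then p else q) = a.count i • p + (a.filter (· ≠ i)).card • q := by
  induction a using Multiset.induction with
  | empty => simp
  | cons j a ih =>
    rw [cons_bind, ih]
    by_cases h : j = i
    · subst h; simp; module
    · simp [h, Ne.symm h]; module

theorem count_add_card_filter_ne (a : Multiset ℕ) (i : ℕ) :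
    a.count i + (a.filter (· ≠ i)).card = a.card := by
  have h := congrArg card (bind_ite_eq a i {0} {0})
  simpa [card_bind, Function.comp_def] using h.symm

theorem bind_double (a : Multiset ℕ) (i : ℕ) :
    (a.bind fun j => if j = i then 2 • {i} else {j}) = a + a.count i • {i} := by
  induction a using Multiset.induction with
  | empty => simp
  | cons j a ih =>
    rw [cons_bind, ih, ← singleton_add]
    by_cases h : j = i
    · subst h
      simp only [if_true, count_add, count_singleton_self, add_nsmul]
      module
    · simp only [if_neg h, count_add, count_singleton, if_neg (Ne.symm h), zero_add]
      module

theorem bind_const_right (a : Multiset ℕ) (p : Multiset ℕ) :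
    (a.bind fun _ => p) = a.card • p := by
  induction a using Multiset.induction with
  | empty => simp
  | cons j a ih => rw [cons_bind, ih, card_cons]; module

theorem exists_count_eq (S : Finset ℕ) (f : ℕ → ℕ) :
    ∃ a : Multiset ℕ, ∀ i, a.count i = if i ∈ S then f i else 0 := by
  refine ⟨∑ i ∈ S, f i • {i}, fun i => ?_⟩
  rw [count_sum']
  simp [count_nsmul, count_singleton]

end Multiset


namespace FullyInvariant

variable {R : Multiset ℕ → Multiset ℕ → Prop}

theorem absorbs_add (hR : FullyInvariant R) {a d e : Multiset ℕ} (hd : WordAbsorbs R a d)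
    (he : WordAbsorbs R a e) : WordAbsorbs R a (d + e) := by
  have h := hR.trans he (hR.add_right e hd)
  rwa [add_assoc] at h

theorem absorbs_nsmul (hR : FullyInvariant R) {a d : Multiset ℕ} (hd : WordAbsorbs R a d) (k : ℕ) :
    WordAbsorbs R a (k • d) := by
  induction k with
  | zero => simpa [WordAbsorbs] using hR.refl a
  | succ k ih => rw [succ_nsmul]; exact hR.absorbs_add ih hd

theorem absorbs_cancel (hR : FullyInvariant R) {a d e : Multiset ℕ} (h : WordAbsorbs R a (d + e))
    (hd : WordAbsorbs R a d) : WordAbsorbs R a e := by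
  have h1 := hR.add_right e hd
  rw [add_assoc] at h1
  exact hR.trans h (hR.symm h1)

theorem absorbs_of_rel (hR : FullyInvariant R) {a b d : Multiset ℕ} (hab : R a b)
    (h : WordAbsorbs R b d) : WordAbsorbs R a d :=
  hR.trans (hR.trans hab h) (hR.symm (hR.add_right d hab))

theorem absorbs_mono (hR : FullyInvariant R) {a b d : Multiset ℕ} (hab : a ≤ b)
    (h : WordAbsorbs R a d) : WordAbsorbs R b d := by
  obtain ⟨c, rfl⟩ := Multiset.le_iff_exists_add.1 hab
  have := hR.add_right c h
  rwa [add_right_comm] at this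

theorem absorbs_chain (hR : FullyInvariant R) {a b d e : Multiset ℕ} (had : WordAbsorbs R a d)
    (hb : b ≤ a + d) (h : WordAbsorbs R b e) : WordAbsorbs R a e :=
  hR.absorbs_of_rel had (hR.absorbs_mono hb h)

theorem absorbs_bind (hR : FullyInvariant R) {a d : Multiset ℕ} (φ : ℕ → Multiset ℕ)
    (hφ : ∀ i, φ i ≠ 0) (h : WordAbsorbs R a d) : WordAbsorbs R (a.bind φ) (d.bind φ) := by
  have := hR.bind φ hφ h
  rwa [add_bind] at this

theorem absorbs_nsmul_of_forall (hR : FullyInvariant R) {s a : Multiset ℕ} {n : ℕ}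
    (h : ∀ i ∈ a, WordAbsorbs R s (n • {i})) : WordAbsorbs R s (n • a) := by
  induction a using Multiset.induction with
  | empty => simpa [WordAbsorbs] using hR.refl s
  | cons i a ih =>
    rw [← singleton_add, nsmul_add]
    exact hR.absorbs_add (h i (by simp)) (ih fun j hj => h j (by simp [hj]))

theorem absorbs_of_rel_nsmul (hR : FullyInvariant R) {A B : ℕ} {p : Multiset ℕ}
    (h : R (A • p) (B • p)) : WordAbsorbs R (A • p) (((A - B) + (B - A)) • p) := by
  rcases le_total A B with hAB | hAB
  · obtain ⟨k, rfl⟩ := Nat.exists_eq_add_of_le hAB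
    simpa [WordAbsorbs, add_nsmul] using h
  · obtain ⟨k, rfl⟩ := Nat.exists_eq_add_of_le hAB
    have : WordAbsorbs R (B • p) (k • p) := by simpa [WordAbsorbs, add_nsmul] using hR.symm h
    simpa using hR.absorbs_mono (b := (B + k) • p) (by rw [add_nsmul]; exact le_self_add) this

theorem bind_two (hR : FullyInvariant R) {a b : Multiset ℕ} (h : R a b) (i : ℕ)
    {p q : Multiset ℕ} (hp : p ≠ 0) (hq : q ≠ 0) :
    R (a.count i • p + (a.filter (· ≠ i)).card • q)
      (b.count i • p + (b.filter (· ≠ i)).card • q) := by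
  rw [← bind_ite_eq, ← bind_ite_eq]
  exact hR.bind _ (fun j => by split_ifs <;> assumption) h

/-- Every nontrivial identity implies a nontrivial identity in one letter. -/
theorem exists_period (hR : FullyInvariant R) {a b : Multiset ℕ} (h : R a b) (hab : a ≠ b)
    {p : Multiset ℕ} (hp : p ≠ 0) : ∃ T e : ℕ, 1 ≤ e ∧ WordAbsorbs R (T • p) (e • p) := by
  by_cases hc : a.card = b.card
  · obtain ⟨i, hi⟩ : ∃ i, a.count i ≠ b.count i := by
      by_contra! hcon
      exact hab (Multiset.ext.2 hcon)
    have h2 := hR.bind_two h i (p := 2 • p) (q := p) (by simpa using hp) hp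
    rw [← mul_nsmul', ← mul_nsmul', ← add_nsmul, ← add_nsmul] at h2
    have ha := count_add_card_filter_ne a i
    have hb := count_add_card_filter_ne b i
    exact ⟨_, _, by omega, hR.absorbs_of_rel_nsmul h2⟩
  · have h2 := hR.bind (fun _ => p) (fun _ => hp) h
    rw [bind_const_right, bind_const_right] at h2
    exact ⟨_, _, by omega, hR.absorbs_of_rel_nsmul h2⟩

/-- Words have the same counts modulo `q`: the identities of Abelian groups of exponent `q`. -/
def _root_.CountModEq (q : ℕ) (a b : Multiset ℕ) : Prop := ∀ i, a.count i ≡ b.count i [MOD q]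

/-- Words have the same letters: the identities of semilattices. -/
def _root_.SameLetters (a b : Multiset ℕ) : Prop := ∀ i, i ∈ a ↔ i ∈ b

/-- Words have the same letters and the same linear letters: the identities of `C₂`. -/
def _root_.SameLinear (a b : Multiset ℕ) : Prop :=
  ∀ i, min (a.count i) 2 = min (b.count i) 2

/-- Words are not separated by the set `D`. -/
def _root_.SameSide (D : Set (Multiset ℕ)) (a b : Multiset ℕ) : Prop := a ∈ D ↔ b ∈ D

theorem exists_absorbs_of_not_countModEq (hR : FullyInvariant R) {q : ℕ} (hq : 0 < q)
    (h : ¬ R ≤ CountModEq q) {p : Multiset ℕ} (hp : p ≠ 0) :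
    ∃ A e : ℕ, ¬ q ∣ e ∧ WordAbsorbs R (A • p) (e • p) := by
  simp only [Pi.le_def, CountModEq, not_forall, le_Prop_eq] at h
  obtain ⟨a, b, hab, i, hi⟩ := h
  have h2 := hR.bind_two hab i (p := p) (q := q • p) hp (by simp [hp, hq.ne'])
  rw [← mul_nsmul', ← mul_nsmul', ← add_nsmul, ← add_nsmul] at h2
  refine ⟨_, _, fun hd => hi ?_, hR.absorbs_of_rel_nsmul h2⟩
  have key : ∀ A B : ℕ, q ∣ (A - B) + (B - A) → A ≡ B [MOD q] := by
    intro A B hAB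
    rcases le_total A B with h | h
    · exact (Nat.modEq_iff_dvd' h).2 (by simpa [Nat.sub_eq_zero_of_le h] using hAB)
    · exact ((Nat.modEq_iff_dvd' h).2 (by simpa [Nat.sub_eq_zero_of_le h] using hAB)).symm
  simpa [Nat.ModEq] using key _ _ hd

theorem exists_absorbs_of_not_sameLetters (hR : FullyInvariant R) (h : ¬ R ≤ SameLetters) :
    ∃ A c : ℕ, 1 ≤ c ∧ ∀ p q : Multiset ℕ, p ≠ 0 → WordAbsorbs R (A • p) (c • q) := by
  obtain ⟨a, b, i, hab, hia, hib⟩ : ∃ a b i, R a b ∧ i ∈ a ∧ i ∉ b := by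
    simp only [Pi.le_def, SameLetters, not_forall, le_Prop_eq] at h
    obtain ⟨a, b, hab, i, hi⟩ := h
    by_cases hia : i ∈ a
    · exact ⟨a, b, i, hab, hia, by tauto⟩
    · exact ⟨b, a, i, hR.symm hab, by tauto, hia⟩
  refine ⟨a.card, a.count i, Multiset.one_le_count_iff_mem.2 hia, fun p q hp => ?_⟩
  have h1 := hR.bind_two hab i hp hp
  have h2 := hR.bind_two hab i (p := p + q) (q := p) (by simp [hp]) hp
  rw [count_eq_zero_of_notMem hib, zero_nsmul] at h1 h2
  have h3 := hR.trans h1 (hR.symm h2)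
  rw [← count_add_card_filter_ne a i]
  unfold WordAbsorbs
  convert h3 using 1 <;> module

theorem exists_absorbs_of_not_sameLinear (hR : FullyInvariant R) (h : ¬ R ≤ SameLinear) :
    ∃ A c : ℕ, 1 ≤ c ∧ WordAbsorbs R (A • {0} + {1}) (c • {1}) := by
  obtain ⟨a, b, i, hab, hia, hlt⟩ :
      ∃ a b i, R a b ∧ a.count i < 2 ∧ a.count i < b.count i := by
    simp only [Pi.le_def, SameLinear, not_forall, le_Prop_eq] at h
    obtain ⟨a, b, hab, i, hi⟩ := h
    rcases lt_or_ge (a.count i) (b.count i) with hlt | hge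
    · exact ⟨a, b, i, hab, by omega, hlt⟩
    · exact ⟨b, a, i, hR.symm hab, by omega, by omega⟩
  have hcase : a.count i = 0 ∨ a.count i = 1 := by omega
  rcases hcase with h0 | h1
  · have hns : ¬ R ≤ SameLetters := fun hle => by
      have := hle a b hab i
      rw [← count_pos, ← count_pos] at this
      omega
    obtain ⟨A, c, hc, hA⟩ := hR.exists_absorbs_of_not_sameLetters hns
    exact ⟨A, c, hc, hR.absorbs_mono le_self_add (hA {0} {1} (by simp))⟩
  · have hne : a ≠ b := by rintro rfl; omega
    obtain ⟨T, e, he, hT⟩ := hR.exists_period hab hne (p := {0}) (by simp)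
    have h2 := hR.bind_two hab i (p := {1}) (q := e • {0}) (by simp) (by simp; omega)
    rw [h1, one_nsmul] at h2
    obtain ⟨c, hc⟩ := Nat.exists_eq_add_of_lt hlt
    set m := (a.filter (· ≠ i)).card
    set m' := (b.filter (· ≠ i)).card
    refine ⟨T, c + 1, by omega, ?_⟩
    have h3 := hR.add_right {1} (hR.absorbs_nsmul hT m)
    have h4 := hR.add_right (T • {0}) h2
    have h5 := hR.add_right (b.count i • {1}) (hR.absorbs_nsmul hT m')
    have h6 := hR.trans h3 (b := T • {0} + m • e • {0} + {1})
      (c := T • {0} + m' • e • {0} + b.count i • {1}) (by convert h4 using 1 <;> module)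
    have h7 := hR.trans h6 (hR.symm h5)
    unfold WordAbsorbs
    convert h7 using 1
    rw [hc, h1]; module

theorem exists_absorbs_of_rel_nsmul_singleton (hR : FullyInvariant R) {k x : ℕ}
    {u : Multiset ℕ} (h : R (k • {x}) u) (hu : u ≠ k • {x}) :
    ∃ c : ℕ, 1 ≤ c ∧ WordAbsorbs R (k • {x}) (c • {x}) := by
  by_cases hc : u.card = k
  · obtain ⟨i, hi, hix⟩ : ∃ i ∈ u, i ≠ x := by
      by_contra! hcon
      exact hu (by rw [nsmul_singleton]; exact eq_replicate.2 ⟨hc, hcon⟩)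
    have h2 := hR.bind_two h i (p := 2 • {x}) (q := {x}) (by simp) (by simp)
    have hk : (k • ({x} : Multiset ℕ)).count i = 0 := by simp [hix]
    have hk' := count_add_card_filter_ne (k • ({x} : Multiset ℕ)) i
    simp only [card_nsmul, card_singleton, mul_one] at hk'
    rw [hk, zero_nsmul, zero_add, show ((k • ({x} : Multiset ℕ)).filter (· ≠ i)).card = k by omega,
      ← mul_nsmul', ← add_nsmul] at h2
    have := count_add_card_filter_ne u i
    have := count_pos.2 hi
    exact ⟨_, by omega, hR.absorbs_of_rel_nsmul h2⟩
  · have h2 := hR.bind (fun _ => {x}) (by simp) h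
    rw [bind_const_right, bind_const_right, card_nsmul, card_singleton, mul_one] at h2
    exact ⟨_, by omega, hR.absorbs_of_rel_nsmul h2⟩

theorem exists_absorbs_of_rel_nodup (hR : FullyInvariant R) {w u : Multiset ℕ} (hw : w.Nodup)
    (h : R w u) (hu : u ≠ w) {k : ℕ} (hk : k ∈ w) : ∃ c : ℕ, 1 ≤ c ∧ WordAbsorbs R w (c • {k}) := by
  obtain ⟨r, hr0, hrw, hr⟩ : ∃ r : Multiset ℕ, r ≠ 0 ∧ (∀ i ∈ r, i ∈ w) ∧ WordAbsorbs R w r := by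
    by_cases hsub : ∀ i ∈ w, i ∈ u
    · obtain ⟨r, rfl⟩ := Multiset.le_iff_exists_add.1 ((Multiset.le_iff_subset hw).2 hsub)
      have hr0 : r ≠ 0 := by rintro rfl; simp at hu
      refine ⟨r.map fun j => if j ∈ w then j else k, by simpa using hr0, ?_, ?_⟩
      · intro i hi
        obtain ⟨j, -, rfl⟩ := mem_map.1 hi
        split_ifs <;> assumption
      · have h2 := hR.bind (fun j => {if j ∈ w then j else k}) (by simp) h
        rw [bind_singleton, bind_singleton, map_add] at h2
        rwa [map_congr (g := id) rfl (by simp +contextual), map_id] at h2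
    · push Not at hsub
      obtain ⟨i, hi, hiu⟩ := hsub
      refine ⟨{i}, by simp, by simpa using hi, ?_⟩
      have h2 := hR.bind (fun j => if j = i then 2 • {i} else {j})
        (fun j => by split_ifs <;> simp) h
      rw [bind_double, bind_double, count_eq_zero_of_notMem hiu, count_eq_one_of_mem hw hi,
        one_nsmul, zero_nsmul, add_zero] at h2
      exact hR.trans h (hR.symm h2)
  obtain ⟨i, hi⟩ := exists_mem_of_ne_zero hr0
  have hiw := hrw i hi
  have h2 := hR.absorbs_bind (fun j => {Equiv.swap i k j}) (by simp) hr
  rw [bind_singleton, bind_singleton] at h2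
  have hmap : w.map (Equiv.swap i k) = w := by
    refine (Nodup.ext (hw.map (Equiv.swap i k).injective) hw).2 fun j => ?_
    rw [mem_map]
    constructor
    · rintro ⟨l, hl, rfl⟩
      by_cases h1 : l = i
      · subst h1; simpa using hk
      by_cases h2 : l = k
      · subst h2; simpa using hiw
      rwa [Equiv.swap_apply_of_ne_of_ne h1 h2]
    · intro hj
      refine ⟨Equiv.swap i k j, ?_, by simp⟩
      by_cases h1 : j = i
      · subst h1; simpa using hk
      by_cases h2 : j = k
      · subst h2; simpa using hiw
      rwa [Equiv.swap_apply_of_ne_of_ne h1 h2]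
  rw [hmap] at h2
  set r' := r.map (Equiv.swap i k)
  have hk' : k ∈ r' := mem_map.2 ⟨i, hi, by simp⟩
  have h3 := hR.absorbs_bind (fun j => if j = k then 2 • {k} else {j})
    (fun j => by split_ifs <;> simp) h2
  rw [bind_double, bind_double, count_eq_one_of_mem hw hk, one_nsmul] at h3
  have h4 : WordAbsorbs R w (r' + r'.count k • {k}) :=
    hR.absorbs_chain h2 (by gcongr; simpa using hk') h3
  exact ⟨_, Multiset.one_le_count_iff_mem.2 hk', hR.absorbs_cancel h4 h2⟩

theorem absorbs_square_mul (hR : FullyInvariant R) {x y c : ℕ} (hxy : x ≠ y)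
    (h : WordAbsorbs R (2 • {x} + {y}) (c • {x})) {p q : Multiset ℕ} (hp : p ≠ 0) (hq : q ≠ 0) :
    WordAbsorbs R (2 • p + q) (c • p) := by
  have := hR.absorbs_bind (fun j => if j = x then p else q)
    (fun j => by split_ifs <;> assumption) h
  simpa [nsmul_bind', hxy.symm] using this

theorem exists_absorbs_square_mul (hR : FullyInvariant R) {x y : ℕ} (hxy : x ≠ y)
    {u : Multiset ℕ} (h : R (2 • {x} + {y}) u) (hu : u ≠ 2 • {x} + {y})
    (hu' : u ≠ {x} + 2 • {y}) : ∃ c : ℕ, 1 ≤ c ∧ WordAbsorbs R (2 • {x} + {y}) (c • {x}) := by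
  by_cases hx : x ∈ u
  swap
  · have h2 := hR.bind (fun j => if j = x then 2 • {x} else {j})
        (fun j => by split_ifs <;> simp) h
    rw [bind_double, bind_double, count_eq_zero_of_notMem hx, zero_nsmul, add_zero] at h2
    refine ⟨2, one_le_two, ?_⟩
    have h3 := hR.trans h (hR.symm h2)
    simpa [WordAbsorbs, count_nsmul, count_singleton, hxy] using h3
  by_cases hy : y ∈ u
  swap
  · have h2 := hR.bind (fun j => if j = y then {x} + {y} else {j})
        (fun j => by split_ifs <;> simp) h
    have h3 : (u.bind fun j => if j = y then {x} + {y} else {j}) = u := by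
      conv_rhs => rw [← map_id u, ← bind_singleton]
      refine bind_congr fun j hj => ?_
      rw [if_neg (by rintro rfl; exact hy hj)]; rfl
    rw [h3] at h2
    refine ⟨1, le_rfl, ?_⟩
    have h4 := hR.trans h (hR.symm h2)
    simp only [add_bind, nsmul_bind', singleton_bind, if_neg hxy, if_true] at h4
    unfold WordAbsorbs
    convert h4 using 1
    module
  obtain ⟨a, b, h2, ha, hb, hne, hne'⟩ : ∃ a b : ℕ, R (2 • {x} + {y}) (a • {x} + b • {y}) ∧
      1 ≤ a ∧ 1 ≤ b ∧ ¬ (a = 2 ∧ b = 1) ∧ ¬ (a = 1 ∧ b = 2) := by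
    have h2 := hR.bind (fun j => if j = y then {y} else if j = x then {x} else 2 • {x})
      (fun j => by split_ifs <;> simp) h
    have h3 : ∀ v : Multiset ℕ,
        (v.bind fun j => if j = y then {y} else if j = x then {x} else 2 • {x}) =
          (v.count x + 2 * (v.filter fun j => j ≠ x ∧ j ≠ y).card) • {x} + v.count y • {y} := by
      intro v
      induction v using Multiset.induction with
      | empty => simp
      | cons j v ih =>
        rw [cons_bind, ih]
        by_cases h1 : j = y
        · subst h1; simp [hxy, -singleton_add]; module
        by_cases h2 : j = x
        · subst h2; simp [h1, hxy.symm, -singleton_add]; module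
        · simp [h1, h2, Ne.symm h1, Ne.symm h2]; module
    rw [h3 u, add_bind, nsmul_bind', singleton_bind, singleton_bind, if_neg hxy, if_pos rfl,
      if_pos rfl] at h2
    have hx' := Multiset.one_le_count_iff_mem.2 hx
    have hy' := Multiset.one_le_count_iff_mem.2 hy
    by_cases h0 : (u.filter fun j => j ≠ x ∧ j ≠ y).card = 0
    · have hsupp : ∀ j ∈ u, j = x ∨ j = y := by
        intro j hj
        by_contra! hcon
        have := (filter_eq_nil.1 (card_eq_zero.1 h0)) j hj
        exact this hcon
      have hu2 : u = u.count x • {x} + u.count y • {y} := by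
        ext j
        simp only [count_add, count_nsmul, count_singleton]
        by_cases h1 : j = x
        · subst h1; simp [hxy]
        by_cases h2 : j = y
        · subst h2; simp [hxy.symm]
        · simp only [h1, h2, if_false]
          simp only [mul_zero, add_zero, count_eq_zero]
          intro hj
          rcases hsupp j hj with h | h <;> contradiction
      refine ⟨u.count x, u.count y, by simpa [h0] using h2, hx', hy', ?_, ?_⟩
      · rintro ⟨h1, h2⟩
        rw [h1, h2, one_nsmul] at hu2
        exact hu hu2
      · rintro ⟨h1, h2⟩
        rw [h1, h2, one_nsmul] at hu2
        exact hu' hu2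
    · refine ⟨_, _, h2, by omega, hy', by omega, by omega⟩
  rcases Nat.lt_or_ge b 2 with hb2 | hb2
  · obtain rfl : b = 1 := by omega
    rcases Nat.lt_or_ge a 3 with ha3 | ha3
    · obtain rfl : a = 1 := by omega
      refine ⟨1, le_rfl, ?_⟩
      have h3 : WordAbsorbs R ({x} + {y}) {x} := by
        have := hR.symm h2
        unfold WordAbsorbs
        convert this using 1 <;> module
      simpa using hR.absorbs_mono (b := 2 • {x} + {y})
        (by rw [two_nsmul]; gcongr; exact le_self_add) h3
    · obtain ⟨c, rfl⟩ := Nat.exists_eq_add_of_le ha3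
      refine ⟨c + 1, by omega, ?_⟩
      unfold WordAbsorbs
      convert h2 using 1
      module
  · obtain ⟨b, rfl⟩ := Nat.exists_eq_add_of_le hb2
    obtain ⟨a, rfl⟩ := Nat.exists_eq_add_of_le ha
    have h3 := hR.bind (fun j => {Equiv.swap x y j}) (by simp) h2
    simp only [add_bind, nsmul_bind', singleton_bind, Equiv.swap_apply_left,
      Equiv.swap_apply_right] at h3
    have h4 := hR.add_right (a • {x} + b • {y}) h3
    have hpos : 1 ≤ a + b := by omega
    have h6 : WordAbsorbs R (2 • {x} + {y}) ((a + b) • ({x} + {y})) := by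
      refine hR.trans h2 (b := (1 + a) • {x} + (2 + b) • {y}) ?_
      convert h4 using 1 <;> module
    have h7 := hR.absorbs_bind (fun j => if j = y then {x} + {y} else {j})
        (fun j => by split_ifs <;> simp) h6
    simp only [add_bind, nsmul_bind', singleton_bind, if_neg hxy, if_true] at h7
    obtain ⟨m, hm⟩ := Nat.exists_eq_add_of_le hpos
    have h8 := hR.absorbs_chain h6 ?_ h7
    · refine ⟨a + b, hpos, hR.absorbs_cancel (d := (a + b) • ({x} + {y})) ?_ h6⟩
      convert h8 using 1
      module
    · rw [hm, Multiset.le_iff_exists_add]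
      exact ⟨m • ({x} + {y}) + {y}, by module⟩

end FullyInvariant

/-- An equivalence that contains one of two fully invariant congruences as soon as it
contains their intersection. -/
structure PrimeRel (E : Multiset ℕ → Multiset ℕ → Prop) : Prop where
  equivalence : Equivalence E
  prime : ∀ {R R' : Multiset ℕ → Multiset ℕ → Prop}, FullyInvariant R → FullyInvariant R' →
    R ⊓ R' ≤ E → R ≤ E ∨ R' ≤ E

theorem primeRel_of_absorbs {E : Multiset ℕ → Multiset ℕ → Prop} (hE : Equivalence E)
    {f : ℕ → Multiset ℕ} (hf : Monotone f) {d : Multiset ℕ}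
    (h : ∀ {R}, FullyInvariant R → ¬ R ≤ E → ∃ A c : ℕ, 1 ≤ c ∧ WordAbsorbs R (f A) (c • d))
    (hd : ∀ A c : ℕ, 1 ≤ c → ¬ E (f A) (f A + c • d)) : PrimeRel E where
  equivalence := hE
  prime := by
    intro R R' hR hR' hle
    by_contra! hcon
    obtain ⟨A, c, hc, hA⟩ := h hR hcon.1
    obtain ⟨A', c', hc', hA'⟩ := h hR' hcon.2
    refine hd (A + A') (c * c') (Nat.mul_pos hc hc') (hle _ _ ⟨?_, ?_⟩)
    · rw [mul_nsmul]
      exact hR.absorbs_nsmul (hR.absorbs_mono (hf (Nat.le_add_right _ _)) hA) c'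
    · rw [mul_nsmul']
      exact hR'.absorbs_nsmul (hR'.absorbs_mono (hf (Nat.le_add_left _ _)) hA') c

theorem CountModEq.equivalence (q : ℕ) : Equivalence (CountModEq q) :=
  ⟨fun _ _ => rfl, fun h i => (h i).symm, fun h h' i => (h i).trans (h' i)⟩

theorem SameLetters.equivalence : Equivalence SameLetters :=
  ⟨fun _ _ => Iff.rfl, fun h i => (h i).symm, fun h h' i => (h i).trans (h' i)⟩

theorem SameLinear.equivalence : Equivalence SameLinear :=
  ⟨fun _ _ => rfl, fun h i => (h i).symm, fun h h' i => (h i).trans (h' i)⟩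

theorem SameSide.equivalence (D : Set (Multiset ℕ)) : Equivalence (SameSide D) :=
  ⟨fun _ => Iff.rfl, fun h => Iff.symm h, fun h h' => Iff.trans h h'⟩

theorem primeRel_countModEq {p : ℕ} (hp : p.Prime) (k : ℕ) : PrimeRel (CountModEq (p ^ k)) where
  equivalence := CountModEq.equivalence _
  prime := by
    intro R R' hR hR' hle
    by_contra! hcon
    have hq : 0 < p ^ k := pow_pos hp.pos k
    obtain ⟨A, e, he, hA⟩ :=
      hR.exists_absorbs_of_not_countModEq hq hcon.1 (singleton_ne_zero 0)
    obtain ⟨A', e', he', hA'⟩ :=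
      hR'.exists_absorbs_of_not_countModEq hq hcon.2 (singleton_ne_zero 0)
    have key : CountModEq (p ^ k) ((A + A') • {0}) ((A + A') • {0} + e.lcm e' • {0}) := by
      refine hle _ _ ⟨?_, ?_⟩
      · obtain ⟨m, hm⟩ := Nat.dvd_lcm_left e e'
        rw [hm, mul_nsmul]
        refine hR.absorbs_nsmul (hR.absorbs_mono ?_ hA) m
        rw [add_nsmul]; exact le_self_add
      · obtain ⟨m, hm⟩ := Nat.dvd_lcm_right e e'
        rw [hm, mul_nsmul]
        refine hR'.absorbs_nsmul (hR'.absorbs_mono ?_ hA') m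
        rw [add_nsmul]; exact le_add_self
    have h0 := key 0
    simp only [count_add, count_nsmul, count_singleton_self, mul_one] at h0
    have hdvd : p ^ k ∣ e.lcm e' := by
      rw [← Nat.modEq_zero_iff_dvd]
      exact (Nat.ModEq.add_left_cancel' (A + A') h0).symm
    have he0 : e ≠ 0 := by rintro rfl; simp at he
    have he0' : e' ≠ 0 := by rintro rfl; simp at he'
    rw [hp.pow_dvd_iff_le_factorization (Nat.lcm_ne_zero he0 he0'),
      Nat.factorization_lcm he0 he0', Finsupp.sup_apply, le_sup_iff,
      ← hp.pow_dvd_iff_le_factorization he0, ← hp.pow_dvd_iff_le_factorization he0'] at hdvd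
    tauto

theorem primeRel_sameLetters : PrimeRel SameLetters := by
  refine primeRel_of_absorbs SameLetters.equivalence (f := fun A => A • {0}) (d := {1})
    (fun A B h => by dsimp only; gcongr) (fun hR h => ?_) fun A c hc h => ?_
  · obtain ⟨A, c, hc, hA⟩ := hR.exists_absorbs_of_not_sameLetters h
    exact ⟨A, c, hc, hA _ _ (singleton_ne_zero 0)⟩
  · have := h 1
    simp [mem_nsmul] at this
    omega

theorem primeRel_sameLinear : PrimeRel SameLinear := by
  refine primeRel_of_absorbs SameLinear.equivalence (f := fun A => A • {0} + {1}) (d := {1})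
    (fun A B h => by dsimp only; gcongr) (fun hR h => hR.exists_absorbs_of_not_sameLinear h)
    fun A c hc h => ?_
  have := h 1
  simp [count_nsmul] at this
  omega

namespace FullyInvariant

variable {R : Multiset ℕ → Multiset ℕ → Prop}

theorem exists_rel_of_not_sameSide (hR : FullyInvariant R) {D : Set (Multiset ℕ)}
    (h : ¬ R ≤ SameSide D) : ∃ s ∈ D, ∃ u ∉ D, R s u := by
  simp only [Pi.le_def, SameSide, not_forall, le_Prop_eq] at h
  obtain ⟨a, b, hab, hD⟩ := h
  by_cases ha : a ∈ D
  · exact ⟨a, ha, b, by tauto, hab⟩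
  · exact ⟨b, by tauto, a, ha, hR.symm hab⟩

theorem exists_absorbs_of_not_sameSide_nodup (hR : FullyInvariant R) {w : Multiset ℕ}
    (hw : w.Nodup) (h : ¬ R ≤ SameSide {w}) {k : ℕ} (hk : k ∈ w) :
    ∃ c : ℕ, 1 ≤ c ∧ WordAbsorbs R w (c • {k}) := by
  obtain ⟨s, rfl, u, hu, hsu⟩ := hR.exists_rel_of_not_sameSide h
  exact hR.exists_absorbs_of_rel_nodup hw hsu hu hk

theorem exists_absorbs_of_not_sameSide_nsmul (hR : FullyInvariant R) {k x : ℕ}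
    (h : ¬ R ≤ SameSide {k • {x}}) : ∃ c : ℕ, 1 ≤ c ∧ WordAbsorbs R (k • {x}) (c • {x}) := by
  obtain ⟨s, rfl, u, hu, hsu⟩ := hR.exists_rel_of_not_sameSide h
  exact hR.exists_absorbs_of_rel_nsmul_singleton hsu hu

/-- The words `x²y` and `xy²`. -/
def _root_.squareMulPair (x y : ℕ) : Set (Multiset ℕ) := {2 • {x} + {y}, {x} + 2 • {y}}

theorem exists_absorbs_of_not_sameSide_squareMulPair (hR : FullyInvariant R) {x y : ℕ}
    (hxy : x ≠ y) (h : ¬ R ≤ SameSide (squareMulPair x y)) :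
    ∃ c : ℕ, 1 ≤ c ∧ WordAbsorbs R (2 • {x} + {y}) (c • {x}) := by
  obtain ⟨s, hs, u, hu, hsu⟩ := hR.exists_rel_of_not_sameSide h
  simp only [squareMulPair, Set.mem_insert_iff, Set.mem_singleton_iff, not_or] at hs hu
  rcases hs with rfl | rfl
  · exact hR.exists_absorbs_square_mul hxy hsu hu.1 hu.2
  · rw [add_comm] at hsu
    obtain ⟨c, hc, h⟩ := hR.exists_absorbs_square_mul hxy.symm hsu
      (by rw [add_comm]; exact hu.2) (by rw [add_comm]; exact hu.1)
    exact ⟨c, hc, hR.absorbs_square_mul hxy.symm h (by simp) (by simp)⟩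

end FullyInvariant

theorem primeRel_sameSide {D : Set (Multiset ℕ)} {w d : Multiset ℕ} (hw : w ∈ D)
    (hd : ∀ c : ℕ, 1 ≤ c → w + c • d ∉ D)
    (h : ∀ {R}, FullyInvariant R → ¬ R ≤ SameSide D →
      ∃ c : ℕ, 1 ≤ c ∧ WordAbsorbs R w (c • d)) : PrimeRel (SameSide D) :=
  primeRel_of_absorbs (SameSide.equivalence D) (f := fun _ => w) (d := d)
    monotone_const (fun hR hle => ⟨0, h hR hle⟩) fun _ c hc hcon => hd c hc (hcon.1 hw)

theorem primeRel_sameSide_nodup {w : Multiset ℕ} (hw : w.Nodup) (h0 : w ≠ 0) :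
    PrimeRel (SameSide {w}) := by
  obtain ⟨k, hk⟩ := exists_mem_of_ne_zero h0
  refine primeRel_sameSide (w := w) (d := {k}) rfl (fun c hc => ?_)
    fun hR hle => hR.exists_absorbs_of_not_sameSide_nodup hw hle hk
  simp; omega

theorem primeRel_sameSide_nsmul (k x : ℕ) : PrimeRel (SameSide {k • {x}}) := by
  refine primeRel_sameSide (w := k • {x}) (d := {x}) rfl (fun c hc => ?_)
    fun hR hle => hR.exists_absorbs_of_not_sameSide_nsmul hle
  simp; omega

theorem primeRel_sameSide_squareMulPair {x y : ℕ} (hxy : x ≠ y) :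
    PrimeRel (SameSide (squareMulPair x y)) := by
  refine primeRel_sameSide (w := 2 • {x} + {y}) (d := {x}) (Or.inl rfl) (fun c hc => ?_)
    fun hR hle => hR.exists_absorbs_of_not_sameSide_squareMulPair hxy hle
  rintro (h | h) <;>
  · have := congrArg card h
    simp at this
    omega

/-- The test relations for varieties satisfying `x²y = xⁿ⁺²y` for some `n ≥ 1`. -/
inductive PeriodicTest : (Multiset ℕ → Multiset ℕ → Prop) → Prop
  | countModEq {p : ℕ} (hp : p.Prime) (k : ℕ) : PeriodicTest (CountModEq (p ^ k))
  | sameLetters : PeriodicTest SameLetters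
  | sameLinear : PeriodicTest SameLinear
  | nodup {w : Multiset ℕ} (hw : w.Nodup) (h0 : w ≠ 0) : PeriodicTest (SameSide {w})
  | square (x : ℕ) : PeriodicTest (SameSide {2 • {x}})

/-- The test relations for varieties satisfying `x²y = xy²`. -/
inductive BalancedTest : (Multiset ℕ → Multiset ℕ → Prop) → Prop
  | sameLetters : BalancedTest SameLetters
  | nodup {w : Multiset ℕ} (hw : w.Nodup) (h0 : w ≠ 0) : BalancedTest (SameSide {w})
  | square (x : ℕ) : BalancedTest (SameSide {2 • {x}})
  | cube (x : ℕ) : BalancedTest (SameSide {3 • {x}})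
  | squareMul {x y : ℕ} (hxy : x ≠ y) : BalancedTest (SameSide (squareMulPair x y))

theorem PeriodicTest.primeRel {E : Multiset ℕ → Multiset ℕ → Prop} (h : PeriodicTest E) :
    PrimeRel E := by
  cases h with
  | countModEq hp k => exact primeRel_countModEq hp k
  | sameLetters => exact primeRel_sameLetters
  | sameLinear => exact primeRel_sameLinear
  | nodup hw h0 => exact primeRel_sameSide_nodup hw h0
  | square x => exact primeRel_sameSide_nsmul 2 x

theorem BalancedTest.primeRel {E : Multiset ℕ → Multiset ℕ → Prop} (h : BalancedTest E) :
    PrimeRel E := by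
  cases h with
  | sameLetters => exact primeRel_sameLetters
  | nodup hw h0 => exact primeRel_sameSide_nodup hw h0
  | square x => exact primeRel_sameSide_nsmul 2 x
  | cube x => exact primeRel_sameSide_nsmul 3 x
  | squareMul hxy => exact primeRel_sameSide_squareMulPair hxy

theorem Multiset.exists_two_le_count {s : Multiset ℕ} (h : ¬ s.Nodup) : ∃ x, 2 ≤ s.count x := by
  rw [nodup_iff_count_le_one] at h
  push Not at h
  exact h

theorem Nat.modEq_of_forall_prime_pow {n a b : ℕ}
    (h : ∀ p k : ℕ, p.Prime → p ^ k ∣ n → a ≡ b [MOD p ^ k]) : a ≡ b [MOD n] := by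
  wlog hab : a ≤ b
  · exact (this (fun p k hp hk => (h p k hp hk).symm) (le_of_not_ge hab)).symm
  rw [Nat.modEq_iff_dvd' hab, Nat.dvd_iff_prime_pow_dvd_dvd]
  exact fun p k hp hk => (Nat.modEq_iff_dvd' hab).1 (h p k hp hk)

namespace FullyInvariant

variable {R : Multiset ℕ → Multiset ℕ → Prop}

theorem exists_rel_not_nodup (hR : FullyInvariant R) {s : Multiset ℕ} {i c : ℕ} (hi : i ∈ s)
    (hc : 1 ≤ c) (h : WordAbsorbs R s (c • {i})) (k : ℕ) :
    ∃ s', R s s' ∧ ¬ s'.Nodup ∧ k ≤ s'.card := by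
  refine ⟨_, hR.absorbs_nsmul h (k + 1), fun hn => ?_, ?_⟩
  · have := nodup_iff_count_le_one.1 hn i
    have := Multiset.one_le_count_iff_mem.2 hi
    have : 1 ≤ (k + 1) * c := Nat.mul_pos (Nat.succ_pos k) hc
    simp only [count_add, count_nsmul, count_singleton_self, mul_one] at *
    omega
  · have : k + 1 ≤ (k + 1) * c := Nat.le_mul_of_pos_right _ hc
    simp only [card_add, card_nsmul, card_singleton, mul_one]
    omega

section Periodic

variable {n : ℕ}

theorem absorbs_of_two_le_count (hR : FullyInvariant R)
    (hn : WordAbsorbs R (2 • {0} + {1}) (n • {0})) {s : Multiset ℕ} (hs : 3 ≤ s.card) {i : ℕ}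
    (hi : 2 ≤ s.count i) : WordAbsorbs R s (n • {i}) := by
  obtain ⟨r, rfl⟩ := Multiset.le_iff_exists_add.1
    (show 2 • {i} ≤ s by rw [nsmul_singleton]; exact le_count_iff_replicate_le.1 hi)
  have hr : r ≠ 0 := by rintro rfl; simp at hs
  exact hR.absorbs_square_mul zero_ne_one hn (singleton_ne_zero i) hr

theorem rel_of_absorbs_square_letters (hR : FullyInvariant R) {s t : Multiset ℕ}
    (hs : ∀ i, 2 ≤ s.count i → WordAbsorbs R s (n • {i}))
    (ht : ∀ i, 2 ≤ t.count i → WordAbsorbs R t (n • {i})) (hlin : SameLinear s t)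
    (hmod : CountModEq n s t) : R s t := by
  obtain ⟨a, ha⟩ := exists_count_eq t.toFinset fun i => (t.count i - s.count i) / n
  obtain ⟨b, hb⟩ := exists_count_eq s.toFinset fun i => (s.count i - t.count i) / n
  have ha' : ∀ i, a.count i = (t.count i - s.count i) / n := fun i => by
    rw [ha]
    split_ifs with h
    · rfl
    · rw [mem_toFinset, ← count_eq_zero] at h
      simp [h]
  have hb' : ∀ i, b.count i = (s.count i - t.count i) / n := fun i => by
    rw [hb]
    split_ifs with h
    · rfl
    · rw [mem_toFinset, ← count_eq_zero] at h
      simp [h]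
  have hsa : WordAbsorbs R s (n • a) := hR.absorbs_nsmul_of_forall fun i hi => by
    refine hs i ?_
    rw [← count_pos, ha'] at hi
    have := (Nat.div_pos_iff.1 hi).1
    have := (Nat.div_pos_iff.1 hi).2
    have := hlin i
    omega
  have htb : WordAbsorbs R t (n • b) := hR.absorbs_nsmul_of_forall fun i hi => by
    refine ht i ?_
    rw [← count_pos, hb'] at hi
    have := (Nat.div_pos_iff.1 hi).1
    have := (Nat.div_pos_iff.1 hi).2
    have := hlin i
    omega
  have heq : s + n • a = t + n • b := by
    ext i
    simp only [count_add, count_nsmul, ha', hb']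
    rcases le_total (s.count i) (t.count i) with h | h
    · rw [Nat.mul_div_cancel' ((Nat.modEq_iff_dvd' h).1 (hmod i)), Nat.sub_eq_zero_of_le h]
      simp [h]
    · rw [Nat.mul_div_cancel' ((Nat.modEq_iff_dvd' h).1 (hmod i).symm), Nat.sub_eq_zero_of_le h]
      simp [h]
  unfold WordAbsorbs at hsa htb
  rw [← heq] at htb
  exact hR.trans hsa (hR.symm htb)

theorem rel_of_sameLinear_of_countModEq (hR : FullyInvariant R)
    (hn : WordAbsorbs R (2 • {0} + {1}) (n • {0})) {s t : Multiset ℕ} (hs : 3 ≤ s.card)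
    (ht : 3 ≤ t.card) (hlin : SameLinear s t) (hmod : CountModEq n s t) : R s t :=
  hR.rel_of_absorbs_square_letters (fun _ => hR.absorbs_of_two_le_count hn hs)
    (fun _ => hR.absorbs_of_two_le_count hn ht) hlin hmod

theorem countModEq_of_minimal (hR : FullyInvariant R) (h1 : 1 ≤ n)
    (hn : WordAbsorbs R (2 • {0} + {1}) (n • {0}))
    (hmin : ∀ m : ℕ, 1 ≤ m → WordAbsorbs R (2 • {0} + {1}) (m • {0}) → n ≤ m)
    {q : ℕ} (hq : 0 < q) (hqn : q ∣ n) : R ≤ CountModEq q := by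
  by_contra hcon
  obtain ⟨A, e, he, hA⟩ :=
    hR.exists_absorbs_of_not_countModEq hq hcon (singleton_ne_zero 0)
  have hAe : WordAbsorbs R (2 • {0} + {1}) (e • {0}) := by
    refine hR.absorbs_chain (hR.absorbs_nsmul hn A) ?_ hA
    rw [← mul_nsmul']
    exact (nsmul_le_nsmul_left (zero_le _) (Nat.le_mul_of_pos_right A h1)).trans le_add_self
  rw [← Nat.div_add_mod e n, add_nsmul] at hAe
  have hd := hR.absorbs_nsmul hn (e / n)
  rw [← mul_nsmul', mul_comm] at hd
  have h2 := hmin (e % n) (Nat.pos_of_ne_zero fun h0 => he (hqn.trans (Nat.dvd_of_mod_eq_zero h0)))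
    (hR.absorbs_cancel hAe hd)
  have := Nat.mod_lt e h1
  omega

theorem rel_of_absorbs_letters (hR : FullyInvariant R) (h1 : 1 ≤ n)
    (hn : WordAbsorbs R (2 • {0} + {1}) (n • {0})) {s t : Multiset ℕ} (hs : 3 ≤ s.card)
    (ht : 3 ≤ t.card) (hmod : CountModEq n s t) {c : ℕ} (hc : 1 ≤ c)
    (hs' : ∀ i ∈ s + t, WordAbsorbs R s (c • {i}))
    (ht' : ∀ i ∈ s + t, WordAbsorbs R t (c • {i})) : R s t := by
  have hs2 := hR.absorbs_nsmul (hR.absorbs_nsmul_of_forall hs') (2 * n)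
  have ht2 := hR.absorbs_nsmul (hR.absorbs_nsmul_of_forall ht') (2 * n)
  refine hR.trans hs2 (hR.trans ?_ (hR.symm ht2))
  refine hR.rel_of_sameLinear_of_countModEq hn ?_ ?_ (fun i => ?_) fun i => ?_
  · rw [card_add]; omega
  · rw [card_add]; omega
  · simp only [count_add, count_nsmul, mul_assoc]
    rcases Nat.eq_zero_or_pos (s.count i + t.count i) with h | h
    · have h2 : s.count i = 0 := by omega
      have h3 : t.count i = 0 := by omega
      simp [h2, h3]
    · have := Nat.mul_pos h1 (Nat.mul_pos hc h)
      omega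
  · simp only [count_add, count_nsmul]
    exact (hmod i).add_right _

/-- In the presence of `x²y = xⁿ⁺²y`, a fully invariant congruence is determined by the
test relations containing it. -/
theorem rel_of_periodicTest (hR : FullyInvariant R)
    (hlaw : ∃ n : ℕ, 1 ≤ n ∧ WordAbsorbs R (2 • {0} + {1}) (n • {0})) {s t : Multiset ℕ}
    (hs : s ≠ 0) (ht : t ≠ 0) (hE : ∀ E, PeriodicTest E → R ≤ E → E s t) : R s t := by
  classical
  have lift : ∀ {s t : Multiset ℕ}, s ≠ 0 → (∀ E, PeriodicTest E → R ≤ E → E s t) →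
      R s t ∨ ∃ s', R s s' ∧ ¬ s'.Nodup ∧ 3 ≤ s'.card := by
    intro s t hs hE
    by_cases hnd : s.Nodup
    · by_cases hle : R ≤ SameSide {s}
      · obtain rfl : t = s := (hE _ (.nodup hnd hs) hle).1 rfl
        exact Or.inl (hR.refl _)
      · obtain ⟨k, hk⟩ := exists_mem_of_ne_zero hs
        obtain ⟨c, hc, h⟩ := hR.exists_absorbs_of_not_sameSide_nodup hnd hle hk
        exact Or.inr (hR.exists_rel_not_nodup hk hc h 3)
    · by_cases h3 : 3 ≤ s.card
      · exact Or.inr ⟨s, hR.refl s, hnd, h3⟩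
      · obtain ⟨x, hx⟩ := exists_two_le_count hnd
        obtain rfl : s = 2 • {x} := by
          rw [nsmul_singleton]
          exact (eq_of_le_of_card_le (le_count_iff_replicate_le.1 hx) (by simp; omega)).symm
        by_cases hle : R ≤ SameSide {2 • {x}}
        · obtain rfl : t = 2 • {x} := (hE _ (.square x) hle).1 rfl
          exact Or.inl (hR.refl _)
        · obtain ⟨c, hc, h⟩ := hR.exists_absorbs_of_not_sameSide_nsmul hle
          exact Or.inr (hR.exists_rel_not_nodup (i := x) (by simp) hc h 3)
  rcases lift hs hE with h | ⟨s', hss', hs1, hs3⟩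
  · exact h
  rcases lift ht (fun E h hle => h.primeRel.equivalence.symm (hE E h hle)) with
    h | ⟨t', htt', ht1, ht3⟩
  · exact hR.symm h
  refine hR.trans hss' (hR.trans ?_ (hR.symm htt'))
  have hE' : ∀ E, PeriodicTest E → R ≤ E → E s' t' := fun E h hle =>
    h.primeRel.equivalence.trans (h.primeRel.equivalence.symm (hle _ _ hss'))
      (h.primeRel.equivalence.trans (hE E h hle) (hle _ _ htt'))
  obtain ⟨n, ⟨h1, hn⟩, hmin⟩ : ∃ n : ℕ, (1 ≤ n ∧ WordAbsorbs R (2 • {0} + {1}) (n • {0})) ∧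
      ∀ m : ℕ, 1 ≤ m → WordAbsorbs R (2 • {0} + {1}) (m • {0}) → n ≤ m :=
    ⟨Nat.find hlaw, Nat.find_spec hlaw, fun m hm h => Nat.find_min' hlaw ⟨hm, h⟩⟩
  have hmod : CountModEq n s' t' := fun i => Nat.modEq_of_forall_prime_pow fun p k hp hk =>
    hE' _ (.countModEq hp k)
      (hR.countModEq_of_minimal h1 hn hmin (pow_pos hp.pos k) hk) i
  by_cases hlin : R ≤ SameLinear
  · exact hR.rel_of_sameLinear_of_countModEq hn hs3 ht3 (hE' _ .sameLinear hlin) hmod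
  have power : ∀ {u : Multiset ℕ}, ¬ u.Nodup → 3 ≤ u.card → ∀ A : ℕ,
      ∃ x d, WordAbsorbs R u d ∧ A • {x} ≤ d := by
    intro u hu hu3 A
    obtain ⟨x, hx⟩ := exists_two_le_count hu
    refine ⟨x, _, hR.absorbs_nsmul (hR.absorbs_of_two_le_count hn hu3 hx) A, ?_⟩
    rw [← mul_nsmul']
    exact nsmul_le_nsmul_left (zero_le _) (Nat.le_mul_of_pos_right A h1)
  by_cases hlet : R ≤ SameLetters
  · obtain ⟨A, c, hc, hA⟩ := hR.exists_absorbs_of_not_sameLinear hlin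
    have hletters := hE' _ .sameLetters hlet
    have key : ∀ {u : Multiset ℕ}, ¬ u.Nodup → 3 ≤ u.card → ∀ i ∈ u,
        WordAbsorbs R u (c • {i}) := by
      intro u hu hu3 i hi
      obtain ⟨x, d, hd, hle⟩ := power hu hu3 A
      have h2 := hR.absorbs_bind (fun j => if j = 0 then {x} else {i})
        (fun j => by split_ifs <;> simp) hA
      simp only [add_bind, nsmul_bind', singleton_bind, if_true, if_neg one_ne_zero] at h2
      refine hR.absorbs_chain hd ?_ h2
      rw [add_comm]
      exact add_le_add (singleton_le.2 hi) hle
    refine hR.rel_of_absorbs_letters h1 hn hs3 ht3 hmod hc (fun i hi => key hs1 hs3 i ?_)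
      fun i hi => key ht1 ht3 i ?_
    · rw [mem_add, ← hletters i, or_self] at hi
      exact hi
    · rw [mem_add, hletters i, or_self] at hi
      exact hi
  · obtain ⟨A, c, hc, hA⟩ := hR.exists_absorbs_of_not_sameLetters hlet
    have key : ∀ {u : Multiset ℕ}, ¬ u.Nodup → 3 ≤ u.card → ∀ i, WordAbsorbs R u (c • {i}) := by
      intro u hu hu3 i
      obtain ⟨x, d, hd, hle⟩ := power hu hu3 A
      exact hR.absorbs_chain hd (hle.trans le_add_self) (hA {x} {i} (by simp))
    exact hR.rel_of_absorbs_letters h1 hn hs3 ht3 hmod hc (fun i _ => key hs1 hs3 i)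
      fun i _ => key ht1 ht3 i

end Periodic

section Balanced

theorem rel_square_mul (hR : FullyInvariant R)
    (hq : R (2 • {0} + {1}) ({0} + 2 • {1})) {p q : Multiset ℕ} (hp : p ≠ 0) (hq0 : q ≠ 0) :
    R (2 • p + q) (p + 2 • q) := by
  have := hR.bind (fun j => if j = 0 then p else q) (fun j => by split_ifs <;> assumption) hq
  simpa [nsmul_bind'] using this

theorem absorbs_square_mul_mul (hR : FullyInvariant R)
    (hq : R (2 • {0} + {1}) ({0} + 2 • {1})) {x y z : Multiset ℕ} (hx : x ≠ 0) (hy : y ≠ 0)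
    (hz : z ≠ 0) : WordAbsorbs R (2 • x + y + z) x := by
  have h1 := hR.rel_square_mul hq hx (q := y + z) (by simp [hy])
  have h2 := hR.add_right (2 • z) (hR.symm (hR.rel_square_mul hq hx hy))
  have h3 := hR.add_right (x + y) (hR.symm (hR.rel_square_mul hq hx hz))
  unfold WordAbsorbs
  convert hR.trans h1 (hR.trans (b := x + 2 • y + 2 • z) (c := 2 • x + y + z + x) ?_ ?_) using 1
  · module
  · rw [nsmul_add, add_assoc]; exact hR.refl _
  · refine hR.trans h2 ?_
    convert h3 using 1 <;> module

theorem absorbs_of_mem (hR : FullyInvariant R)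
    (hq : R (2 • {0} + {1}) ({0} + 2 • {1})) {s : Multiset ℕ} (hs : ¬ s.Nodup)
    (h4 : 4 ≤ s.card) {i : ℕ} (hi : i ∈ s) : WordAbsorbs R s {i} := by
  obtain ⟨x, hx⟩ := exists_two_le_count hs
  obtain ⟨r, rfl⟩ := Multiset.le_iff_exists_add.1
    (show 2 • {x} ≤ s by rw [nsmul_singleton]; exact le_count_iff_replicate_le.1 hx)
  have hr : 2 ≤ r.card := by
    rw [card_add, card_nsmul, card_singleton] at h4
    omega
  have hxa : WordAbsorbs R (2 • {x} + r) {x} := by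
    obtain ⟨y, hy⟩ := exists_mem_of_ne_zero (show r ≠ 0 by rintro rfl; simp at hr)
    obtain ⟨r', rfl⟩ := exists_cons_of_mem hy
    have := hR.absorbs_square_mul_mul hq (singleton_ne_zero x) (singleton_ne_zero y) (z := r')
      (by rintro rfl; simp at hr)
    rwa [add_assoc, singleton_add] at this
  by_cases hix : i = x
  · rwa [hix]
  have hir : i ∈ r := by simpa [hix] using hi
  obtain ⟨r', rfl⟩ := exists_cons_of_mem hir
  have h := hR.add_right (r' + {x}) (hR.rel_square_mul hq (singleton_ne_zero x)
    (singleton_ne_zero i))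
  refine hR.trans hxa ?_
  rw [← singleton_add]
  convert h using 1 <;> module

theorem rel_of_sameLetters (hR : FullyInvariant R) {s t : Multiset ℕ}
    (hs : ∀ i ∈ s, WordAbsorbs R s {i}) (ht : ∀ i ∈ t, WordAbsorbs R t {i})
    (hst : SameLetters s t) : R s t := by
  have h1 : WordAbsorbs R s (1 • t) := hR.absorbs_nsmul_of_forall fun i hi => by
    rw [one_nsmul]
    exact hs i ((hst i).2 hi)
  have h2 : WordAbsorbs R t (1 • s) := hR.absorbs_nsmul_of_forall fun i hi => by
    rw [one_nsmul]
    exact ht i ((hst i).1 hi)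
  rw [WordAbsorbs, one_nsmul] at h1 h2
  rw [add_comm] at h2
  exact hR.trans h1 (hR.symm h2)

/-- In the presence of `x²y = xy²`, a fully invariant congruence is determined by the
test relations containing it. -/
theorem rel_of_balancedTest (hR : FullyInvariant R)
    (hq : R (2 • {0} + {1}) ({0} + 2 • {1})) {s t : Multiset ℕ}
    (hs : s ≠ 0) (ht : t ≠ 0) (hE : ∀ E, BalancedTest E → R ≤ E → E s t) : R s t := by
  have lift : ∀ {s t : Multiset ℕ}, s ≠ 0 → (∀ E, BalancedTest E → R ≤ E → E s t) →
      R s t ∨ ∃ s', R s s' ∧ ¬ s'.Nodup ∧ 4 ≤ s'.card := by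
    intro s t hs hE
    have power : ∀ {k x : ℕ}, BalancedTest (SameSide {k • {x}}) → k ≠ 0 → s = k • {x} →
        R s t ∨ ∃ s', R s s' ∧ ¬ s'.Nodup ∧ 4 ≤ s'.card := by
      rintro k x htest hk rfl
      by_cases hle : R ≤ SameSide {k • {x}}
      · obtain rfl : t = k • {x} := (hE _ htest hle).1 rfl
        exact Or.inl (hR.refl _)
      · obtain ⟨c, hc, h⟩ := hR.exists_absorbs_of_not_sameSide_nsmul hle
        exact Or.inr (hR.exists_rel_not_nodup (i := x) (by simp [hk]) hc h 4)
    by_cases hnd : s.Nodup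
    · by_cases hle : R ≤ SameSide {s}
      · obtain rfl : t = s := (hE _ (.nodup hnd hs) hle).1 rfl
        exact Or.inl (hR.refl _)
      · obtain ⟨k, hk⟩ := exists_mem_of_ne_zero hs
        obtain ⟨c, hc, h⟩ := hR.exists_absorbs_of_not_sameSide_nodup hnd hle hk
        exact Or.inr (hR.exists_rel_not_nodup hk hc h 4)
    by_cases h4 : 4 ≤ s.card
    · exact Or.inr ⟨s, hR.refl s, hnd, h4⟩
    obtain ⟨x, hx⟩ := exists_two_le_count hnd
    obtain ⟨r, hr⟩ := Multiset.le_iff_exists_add.1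
      (show 2 • {x} ≤ s by rw [nsmul_singleton]; exact le_count_iff_replicate_le.1 hx)
    have hr1 : r.card ≤ 1 := by
      rw [hr, card_add, card_nsmul, card_singleton] at h4
      omega
    rcases Nat.le_one_iff_eq_zero_or_eq_one.1 hr1 with h0 | h1
    · rw [card_eq_zero.1 h0, add_zero] at hr
      exact power (.square x) two_ne_zero hr
    · obtain ⟨y, rfl⟩ := card_eq_one.1 h1
      by_cases hxy : x = y
      · subst hxy
        exact power (.cube x) three_ne_zero (by rw [hr]; module)
      subst hr
      by_cases hle : R ≤ SameSide (squareMulPair x y)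
      · rcases (hE _ (.squareMul hxy) hle).1 (Or.inl rfl) with rfl | rfl
        · exact Or.inl (hR.refl _)
        · exact Or.inl (hR.rel_square_mul hq (by simp) (by simp))
      · obtain ⟨c, hc, h⟩ := hR.exists_absorbs_of_not_sameSide_squareMulPair hxy hle
        exact Or.inr (hR.exists_rel_not_nodup (i := x) (by simp) hc h 4)
  rcases lift hs hE with h | ⟨s', hss', hs1, hs4⟩
  · exact h
  rcases lift ht (fun E h hle => h.primeRel.equivalence.symm (hE E h hle)) with
    h | ⟨t', htt', ht1, ht4⟩
  · exact hR.symm h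
  refine hR.trans hss' (hR.trans ?_ (hR.symm htt'))
  by_cases hlet : R ≤ SameLetters
  · exact hR.rel_of_sameLetters (fun _ => hR.absorbs_of_mem hq hs1 hs4)
      (fun _ => hR.absorbs_of_mem hq ht1 ht4) fun i => ((hlet _ _ hss' i).symm.trans
        (hE _ .sameLetters hlet i)).trans (hlet _ _ htt' i)
  obtain ⟨A, c, hc, hA⟩ := hR.exists_absorbs_of_not_sameLetters hlet
  have key : ∀ {u : Multiset ℕ}, ¬ u.Nodup → 4 ≤ u.card → ∀ v, WordAbsorbs R u (c • v) := by
    intro u hu hu4 v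
    obtain ⟨x, hx⟩ := exists_two_le_count hu
    have hxu : x ∈ u := count_pos.1 (by omega)
    exact hR.absorbs_chain (hR.absorbs_nsmul (hR.absorbs_of_mem hq hu hu4 hxu) A)
      le_add_self (hA {x} v (by simp))
  refine hR.trans (key hs1 hs4 t') (hR.trans ?_ (hR.symm (key ht1 ht4 s')))
  refine hR.rel_of_sameLetters
    (fun _ => hR.absorbs_of_mem hq (fun h => hs1 (nodup_of_le le_self_add h)) ?_)
    (fun _ => hR.absorbs_of_mem hq (fun h => ht1 (nodup_of_le le_self_add h)) ?_) fun i => ?_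
  · rw [card_add]; omega
  · rw [card_add]; omega
  · simp only [mem_add, mem_nsmul]
    have : c ≠ 0 := by omega
    tauto

end Balanced

end FullyInvariant

/-- The multiset of letters of a word. -/
def letters (w : Word) : Multiset ℕ := w.head ::ₘ (w.tail : Multiset ℕ)

@[simp] theorem letters_of (i : ℕ) : letters (FreeSemigroup.of i) = {i} := rfl

@[simp] theorem letters_mul (s t : Word) : letters (s * t) = letters s + letters t := by
  simpa [letters, ← coe_add, ← cons_coe] using cons_swap _ _ _

theorem letters_ne_zero (w : Word) : letters w ≠ 0 := cons_ne_zero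

theorem exists_letters_eq {a : Multiset ℕ} (ha : a ≠ 0) : ∃ w, letters w = a := by
  obtain ⟨i, hi⟩ := exists_mem_of_ne_zero ha
  obtain ⟨b, rfl⟩ := exists_cons_of_mem hi
  exact ⟨⟨i, b.toList⟩, by simp [letters]⟩

theorem letters_lift (φ : ℕ → Word) (w : Word) :
    letters (FreeSemigroup.lift φ w) = (letters w).bind fun i => letters (φ i) := by
  induction w using FreeSemigroup.recOnMul with
  | ih1 i => simp
  | ih2 i w _ ih => simp [ih]

theorem coe_lift_eq_prod {S : Type} [CommSemigroup S] (σ : ℕ → S) (w : Word) :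
    ((FreeSemigroup.lift σ w : S) : WithOne S) =
      ((letters w).map fun i => (σ i : WithOne S)).prod := by
  induction w using FreeSemigroup.recOnMul with
  | ih1 i => simp
  | ih2 i w _ ih => simp [ih]

theorem lift_eq_of_letters_eq {S : Type} [Semigroup S] (hS : SatS S commId) {s t : Word}
    (h : letters s = letters t) (σ : ℕ → S) :
    FreeSemigroup.lift σ s = FreeSemigroup.lift σ t := by
  let _ : CommSemigroup S :=
    { mul_comm := fun a b => by
        simpa [commId, xw, yw] using hS fun i => if i = 0 then a else b }
  apply WithOne.coe_injective
  rw [coe_lift_eq_prod, coe_lift_eq_prod, h]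

theorem mem_th_iff {V : SgVariety} {e : SgId} :
    e ∈ V.th ↔ ∀ (S : Type) [Semigroup S], Models S V.th → SatS S e :=
  ⟨fun h _ _ hS => hS e h, fun h => V.closed ▸ h⟩

theorem mem_th_of_letters_eq (V : ComVariety) {s t : Word} (h : letters s = letters t) :
    (s, t) ∈ V.1.th :=
  mem_th_iff.2 fun _ _ hS σ => lift_eq_of_letters_eq (hS _ V.2) h σ

theorem mem_th_symm {V : SgVariety} {s t : Word} (h : (s, t) ∈ V.th) : (t, s) ∈ V.th :=
  mem_th_iff.2 fun _ _ hS σ => (hS _ h σ).symm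

theorem mem_th_trans {V : SgVariety} {s t u : Word} (h : (s, t) ∈ V.th) (h' : (t, u) ∈ V.th) :
    (s, u) ∈ V.th :=
  mem_th_iff.2 fun _ _ hS σ => (hS _ h σ).trans (hS _ h' σ)

theorem mem_th_mul_right {V : SgVariety} {s t : Word} (h : (s, t) ∈ V.th) (u : Word) :
    (s * u, t * u) ∈ V.th :=
  mem_th_iff.2 fun _ _ hS σ => by simpa using congrArg (· * _) (hS _ h σ)

theorem lift_lift {S : Type} [Semigroup S] (σ : ℕ → S) (φ : ℕ → Word) (w : Word) :
    FreeSemigroup.lift σ (FreeSemigroup.lift φ w) =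
      FreeSemigroup.lift (fun i => FreeSemigroup.lift σ (φ i)) w := by
  induction w using FreeSemigroup.recOnMul with
  | ih1 i => simp
  | ih2 i w _ ih => simp [ih]

theorem mem_th_lift {V : SgVariety} {s t : Word} (h : (s, t) ∈ V.th) (φ : ℕ → Word) :
    (FreeSemigroup.lift φ s, FreeSemigroup.lift φ t) ∈ V.th :=
  mem_th_iff.2 fun _ _ hS σ => by
    simpa [lift_lift] using hS _ h fun i => FreeSemigroup.lift σ (φ i)

/-- The identities of a commutative variety, as a relation on commutative words. -/
def wordRel (V : ComVariety) (a b : Multiset ℕ) : Prop :=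
  a = b ∨ ∃ s t, letters s = a ∧ letters t = b ∧ (s, t) ∈ V.1.th

theorem wordRel_letters_iff {V : ComVariety} {s t : Word} :
    wordRel V (letters s) (letters t) ↔ (s, t) ∈ V.1.th := by
  refine ⟨?_, fun h => Or.inr ⟨s, t, rfl, rfl, h⟩⟩
  rintro (h | ⟨s', t', hs, ht, h⟩)
  · exact mem_th_of_letters_eq V h
  · exact mem_th_trans (mem_th_of_letters_eq V hs.symm)
      (mem_th_trans h (mem_th_of_letters_eq V ht))

theorem fullyInvariant_wordRel (V : ComVariety) : FullyInvariant (wordRel V) where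
  refl a := Or.inl rfl
  symm := by
    rintro a b (rfl | ⟨s, t, rfl, rfl, h⟩)
    · exact Or.inl rfl
    · exact wordRel_letters_iff.2 (mem_th_symm h)
  trans := by
    rintro a b c (rfl | ⟨s, t, rfl, rfl, h⟩) h'
    · exact h'
    · rcases h' with rfl | ⟨s', t', hs', rfl, h'⟩
      · exact wordRel_letters_iff.2 h
      · exact wordRel_letters_iff.2
          (mem_th_trans h (mem_th_trans (mem_th_of_letters_eq V hs'.symm) h'))
  add_right := by
    rintro a b c (rfl | ⟨s, t, rfl, rfl, h⟩)
    · exact Or.inl rfl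
    · rcases eq_or_ne c 0 with rfl | hc
      · simpa using wordRel_letters_iff.2 h
      · obtain ⟨u, rfl⟩ := exists_letters_eq hc
        rw [← letters_mul, ← letters_mul]
        exact wordRel_letters_iff.2 (mem_th_mul_right h u)
  bind := by
    rintro a b φ hφ (rfl | ⟨s, t, rfl, rfl, h⟩)
    · exact Or.inl rfl
    · choose ψ hψ using fun i => exists_letters_eq (hφ i)
      have := wordRel_letters_iff.2 (mem_th_lift h ψ)
      rw [letters_lift, letters_lift] at this
      simpa only [hψ] using this

/-- The congruence on words induced by a fully invariant congruence on commutative words. -/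
def FullyInvariant.con {R : Multiset ℕ → Multiset ℕ → Prop} (hR : FullyInvariant R) :
    Con Word where
  r s t := R (letters s) (letters t)
  iseqv := ⟨fun _ => hR.refl _, fun h => hR.symm h, fun h h' => hR.trans h h'⟩
  mul' := by
    intro s s' t t' h h'
    rw [letters_mul, letters_mul]
    refine hR.trans (hR.add_right _ h) ?_
    rw [add_comm, add_comm (letters s')]
    exact hR.add_right _ h'

theorem FullyInvariant.rel_of_mem_eqTh {R : Multiset ℕ → Multiset ℕ → Prop}
    (hR : FullyInvariant R) {F : Set SgId} (hF : ∀ e ∈ F, R (letters e.1) (letters e.2))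
    {e : SgId} (he : e ∈ eqTh F) : R (letters e.1) (letters e.2) := by
  have hlift : ∀ (φ : ℕ → Word) (w : Word),
      FreeSemigroup.lift (fun i => (φ i : hR.con.Quotient)) w =
        (FreeSemigroup.lift φ w : hR.con.Quotient) := by
    intro φ w
    induction w using FreeSemigroup.recOnMul with
    | ih1 i => simp
    | ih2 i w _ ih => simp [ih]
  have hmodel : Models hR.con.Quotient F := by
    intro e he σ
    choose φ hφ using fun i => Quotient.exists_rep (σ i)
    obtain rfl : σ = fun i => (φ i : hR.con.Quotient) := funext fun i => (hφ i).symm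
    rw [hlift, hlift, Con.eq]
    change R (letters _) (letters _)
    rw [letters_lift, letters_lift]
    exact hR.bind _ (fun i => letters_ne_zero _) (hF e he)
  have h := he hR.con.Quotient hmodel fun i => (FreeSemigroup.of i : hR.con.Quotient)
  rw [hlift, hlift, Con.eq] at h
  have hid : ∀ w : Word, FreeSemigroup.lift (fun i => (FreeSemigroup.of i : Word)) w = w := by
    intro w
    induction w using FreeSemigroup.recOnMul with
    | ih1 i => simp
    | ih2 i w _ ih => simp [ih]
  rw [hid, hid] at h
  exact h

theorem wordRel_le_of_th_subset {V : ComVariety} {F : Set SgId} (hV : V.1.th ⊆ eqTh F)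
    {R : Multiset ℕ → Multiset ℕ → Prop} (hR : FullyInvariant R)
    (hF : ∀ e ∈ F, R (letters e.1) (letters e.2)) : wordRel V ≤ R := by
  rintro a b (rfl | ⟨s, t, rfl, rfl, h⟩)
  · exact hR.refl _
  · exact hR.rel_of_mem_eqTh hF (hV h)

theorem le_iff_wordRel {V W : ComVariety} : V ≤ W ↔ wordRel W ≤ wordRel V := by
  constructor
  · rintro h a b (rfl | ⟨s, t, rfl, rfl, hst⟩)
    · exact Or.inl rfl
    · exact wordRel_letters_iff.2 (h hst)
  · rintro h ⟨s, t⟩ hst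
    exact wordRel_letters_iff.1 (h _ _ (wordRel_letters_iff.2 hst))

theorem le_of_wordRel {V W : ComVariety}
    (h : ∀ a b, a ≠ 0 → b ≠ 0 → wordRel W a b → wordRel V a b) : V ≤ W := by
  rintro ⟨s, t⟩ hst
  exact wordRel_letters_iff.1
    (h _ _ (letters_ne_zero s) (letters_ne_zero t) (wordRel_letters_iff.2 hst))

theorem wordRel_sup (V W : ComVariety) : wordRel (V ⊔ W) = wordRel V ⊓ wordRel W := by
  refine le_antisymm (le_inf (le_iff_wordRel.1 le_sup_left) (le_iff_wordRel.1 le_sup_right)) ?_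
  rintro a b ⟨rfl | ⟨s, t, rfl, rfl, h⟩, h'⟩
  · exact Or.inl rfl
  · exact wordRel_letters_iff.2 ⟨h, wordRel_letters_iff.1 h'⟩

theorem FullyInvariant.eqvGen_sup {R R' : Multiset ℕ → Multiset ℕ → Prop}
    (hR : FullyInvariant R) (hR' : FullyInvariant R') :
    FullyInvariant (Relation.EqvGen (R ⊔ R')) where
  refl a := .refl a
  symm h := .symm _ _ h
  trans h h' := .trans _ _ _ h h'
  add_right c h := by
    induction h with
    | rel a b h => exact .rel _ _ (h.imp (hR.add_right c) (hR'.add_right c))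
    | refl a => exact .refl _
    | symm _ _ _ ih => exact .symm _ _ ih
    | trans _ _ _ _ _ ih ih' => exact .trans _ _ _ ih ih'
  bind φ hφ h := by
    induction h with
    | rel a b h => exact .rel _ _ (h.imp (hR.bind φ hφ) (hR'.bind φ hφ))
    | refl a => exact .refl _
    | symm _ _ _ ih => exact .symm _ _ ih
    | trans _ _ _ _ _ ih ih' => exact .trans _ _ _ ih ih'

theorem wordRel_inf_le {V W : ComVariety} {E : Multiset ℕ → Multiset ℕ → Prop}
    (hE : Equivalence E) (hV : wordRel V ≤ E) (hW : wordRel W ≤ E) : wordRel (V ⊓ W) ≤ E := by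
  have h : wordRel (V ⊓ W) ≤ Relation.EqvGen (wordRel V ⊔ wordRel W) := by
    refine wordRel_le_of_th_subset (F := V.1.th ∪ W.1.th) subset_rfl
      ((fullyInvariant_wordRel V).eqvGen_sup (fullyInvariant_wordRel W)) ?_
    rintro e (he | he)
    · exact .rel _ _ (Or.inl (wordRel_letters_iff.2 he))
    · exact .rel _ _ (Or.inr (wordRel_letters_iff.2 he))
  intro a b hab
  replace hab := h a b hab
  clear h
  induction hab with
  | rel a b h => exact h.elim (hV a b) (hW a b)
  | refl a => exact hE.refl a
  | symm _ _ _ ih => exact hE.symm ih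
  | trans _ _ _ _ _ ih ih' => exact hE.trans ih ih'

theorem Multiset.count_bind_eq_sum {a : Multiset ℕ} {S : Finset ℕ} (hS : a.toFinset ⊆ S)
    (φ : ℕ → Multiset ℕ) (i : ℕ) :
    (a.bind φ).count i = ∑ j ∈ S, a.count j * (φ j).count i := by
  rw [count_bind, Finset.sum_multiset_map_count]
  refine Finset.sum_subset hS fun j _ hj => ?_
  rw [mem_toFinset, ← count_eq_zero] at hj
  simp [hj]

theorem fullyInvariant_of_count {r : ℕ → ℕ → Prop} (hr : Equivalence r)
    (hadd : ∀ {x y x' y'}, r x y → r x' y' → r (x + x') (y + y'))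
    (hmul : ∀ {x y} z, r x y → r (x * z) (y * z)) :
    FullyInvariant fun a b => ∀ i, r (a.count i) (b.count i) where
  refl _ _ := hr.refl _
  symm h i := hr.symm (h i)
  trans h h' i := hr.trans (h i) (h' i)
  add_right c h i := by
    rw [count_add, count_add]
    exact hadd (h i) (hr.refl _)
  bind {a b} φ _ h i := by
    rw [count_bind_eq_sum (S := a.toFinset ∪ b.toFinset) Finset.subset_union_left,
      count_bind_eq_sum (S := a.toFinset ∪ b.toFinset) Finset.subset_union_right]
    exact Finset.sum_hom_rel (r := r) (hr.refl 0) fun j _ _ hj => hadd (hmul _ (h j)) hj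

theorem fullyInvariant_countModEq (q : ℕ) : FullyInvariant (CountModEq q) :=
  fullyInvariant_of_count (r := fun x y => x ≡ y [MOD q])
    ⟨fun _ => rfl, fun h => h.symm, fun h h' => h.trans h'⟩ (fun h h' => h.add h')
    fun z h => h.mul_right z

theorem fullyInvariant_sameLinear : FullyInvariant SameLinear := by
  refine fullyInvariant_of_count (r := fun x y => min x 2 = min y 2)
    ⟨fun _ => rfl, fun h => h.symm, fun h h' => h.trans h'⟩ (fun h h' => by omega) ?_
  intro x y z h
  rcases Nat.eq_zero_or_pos z with rfl | hz
  · simp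
  · by_cases hxy : x = y
    · rw [hxy]
    · have h1 := Nat.le_mul_of_pos_right x hz
      have h2 := Nat.le_mul_of_pos_right y hz
      omega

theorem fullyInvariant_sameLetters : FullyInvariant SameLetters where
  refl := SameLetters.equivalence.refl
  symm := SameLetters.equivalence.symm
  trans := SameLetters.equivalence.trans
  add_right c h i := by rw [mem_add, mem_add, h i]
  bind φ _ h i := by simp only [mem_bind, h _]

theorem sameLinear_le_sameLetters : SameLinear ≤ SameLetters := by
  intro a b h i
  have := h i
  rw [← count_pos, ← count_pos]
  omega

theorem Multiset.not_nodup_bind {a : Multiset ℕ} (ha : ¬ a.Nodup) {φ : ℕ → Multiset ℕ}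
    (hφ : ∀ i, φ i ≠ 0) : ¬ (a.bind φ).Nodup := by
  obtain ⟨x, hx⟩ := exists_two_le_count ha
  obtain ⟨r, rfl⟩ := Multiset.le_iff_exists_add.1
    (show 2 • {x} ≤ a by rw [nsmul_singleton]; exact le_count_iff_replicate_le.1 hx)
  obtain ⟨i, hi⟩ := exists_mem_of_ne_zero (hφ x)
  intro hn
  have h1 := nodup_iff_count_le_one.1 hn i
  have h2 := count_pos.2 hi
  rw [add_bind, nsmul_bind', singleton_bind, count_add, count_nsmul] at h1
  omega

theorem Multiset.card_le_card_bind (a : Multiset ℕ) {φ : ℕ → Multiset ℕ} (hφ : ∀ i, φ i ≠ 0) :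
    a.card ≤ (a.bind φ).card := by
  induction a using Multiset.induction with
  | empty => simp
  | cons j a ih =>
    have := card_pos.2 (hφ j)
    rw [cons_bind, card_cons, card_add]
    omega

/-- The identities `u = v` where `u` and `v` coincide or both are nonlinear of length at
least three. -/
def NonlinearRel (a b : Multiset ℕ) : Prop :=
  a = b ∨ (¬ a.Nodup ∧ 3 ≤ a.card) ∧ ¬ b.Nodup ∧ 3 ≤ b.card

theorem fullyInvariant_nonlinearRel : FullyInvariant NonlinearRel where
  refl _ := Or.inl rfl
  symm h := h.imp Eq.symm And.symm
  trans := by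
    rintro a b c (rfl | h) (rfl | h')
    exacts [Or.inl rfl, Or.inr h', Or.inr h, Or.inr ⟨h.1, h'.2⟩]
  add_right := by
    rintro a b c (rfl | ⟨h, h'⟩)
    · exact Or.inl rfl
    · refine Or.inr ⟨⟨fun hn => h.1 (nodup_of_le le_self_add hn), ?_⟩,
        fun hn => h'.1 (nodup_of_le le_self_add hn), ?_⟩ <;> rw [card_add] <;> omega
  bind := by
    rintro a b φ hφ (rfl | ⟨h, h'⟩)
    · exact Or.inl rfl
    · exact Or.inr ⟨⟨not_nodup_bind h.1 hφ, h.2.trans (card_le_card_bind a hφ)⟩,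
        not_nodup_bind h'.1 hφ, h'.2.trans (card_le_card_bind b hφ)⟩

theorem nonlinearRel_le_sameSide {w : Multiset ℕ} (hw : w.Nodup ∨ w.card < 3) :
    NonlinearRel ≤ SameSide {w} := by
  rintro a b (rfl | ⟨h, h'⟩)
  · exact Iff.rfl
  · constructor
    · rintro rfl
      rcases hw with hw | hw
      exacts [absurd hw h.1, absurd hw (by omega)]
    · rintro rfl
      rcases hw with hw | hw
      exacts [absurd hw h'.1, absurd hw (by omega)]

/-- The identities `u = v` where `u` and `v` coincide, or are nonlinear of length three with
the same letters, or are both nonlinear of length at least four. -/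
def BalancedRel (a b : Multiset ℕ) : Prop :=
  a = b ∨ (¬ a.Nodup ∧ ¬ b.Nodup) ∧
    ((a.card = 3 ∧ b.card = 3 ∧ SameLetters a b) ∨ (4 ≤ a.card ∧ 4 ≤ b.card))

theorem Multiset.card_bind_eq_or_lt (a : Multiset ℕ) {φ : ℕ → Multiset ℕ} (hφ : ∀ i, φ i ≠ 0) :
    ((∀ j ∈ a, (φ j).card = 1) ∧ (a.bind φ).card = a.card) ∨
      ((∃ j ∈ a, (φ j).card ≠ 1) ∧ a.card < (a.bind φ).card) := by
  by_cases h : ∀ j ∈ a, (φ j).card = 1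
  · refine Or.inl ⟨h, ?_⟩
    rw [card_bind, map_congr (f := card ∘ φ) (g := fun _ => 1) rfl h]
    simp
  · push Not at h
    refine Or.inr ⟨h, ?_⟩
    obtain ⟨j, hj, hj1⟩ := h
    obtain ⟨b, rfl⟩ := exists_cons_of_mem hj
    have := card_pos.2 (hφ j)
    have := card_le_card_bind b hφ
    rw [cons_bind, card_cons, card_add]
    omega

theorem fullyInvariant_balancedRel : FullyInvariant BalancedRel where
  refl _ := Or.inl rfl
  symm h := h.imp Eq.symm fun h => ⟨h.1.symm, h.2.imp
    (fun h => ⟨h.2.1, h.1, SameLetters.equivalence.symm h.2.2⟩) And.symm⟩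
  trans := by
    rintro a b c (rfl | h) (rfl | h')
    · exact Or.inl rfl
    · exact Or.inr h'
    · exact Or.inr h
    · refine Or.inr ⟨⟨h.1.1, h'.1.2⟩, ?_⟩
      rcases h.2 with h3 | h4
      · rcases h'.2 with h3' | h4'
        · exact Or.inl ⟨h3.1, h3'.2.1, SameLetters.equivalence.trans h3.2.2 h3'.2.2⟩
        · omega
      · rcases h'.2 with h3' | h4'
        · omega
        · exact Or.inr ⟨h4.1, h4'.2⟩
  add_right := by
    rintro a b c (rfl | ⟨h, h'⟩)
    · exact Or.inl rfl
    · rcases eq_or_ne c 0 with rfl | hc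
      · rw [add_zero, add_zero]
        exact Or.inr ⟨h, h'⟩
      · have := card_pos.2 hc
        refine Or.inr ⟨⟨fun hn => h.1 (nodup_of_le le_self_add hn),
          fun hn => h.2 (nodup_of_le le_self_add hn)⟩, Or.inr ?_⟩
        rw [card_add, card_add]
        omega
  bind := by
    rintro a b φ hφ (rfl | ⟨h, h'⟩)
    · exact Or.inl rfl
    · refine Or.inr ⟨⟨not_nodup_bind h.1 hφ, not_nodup_bind h.2 hφ⟩, ?_⟩
      rcases h' with ⟨ha, hb, hab⟩ | h4
      · rcases card_bind_eq_or_lt a hφ with ⟨h1, h2⟩ | ⟨⟨j, hj, h1⟩, h2⟩ <;>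
          rcases card_bind_eq_or_lt b hφ with ⟨h1', h2'⟩ | ⟨⟨j', hj', h1'⟩, h2'⟩
        · exact Or.inl ⟨by omega, by omega, fullyInvariant_sameLetters.bind φ hφ hab⟩
        · exact absurd (h1 j' ((hab j').2 hj')) h1'
        · exact absurd (h1' j ((hab j).1 hj)) h1
        · exact Or.inr ⟨by omega, by omega⟩
      · exact Or.inr ⟨h4.1.trans (card_le_card_bind a hφ), h4.2.trans (card_le_card_bind b hφ)⟩

theorem le_sameSide_of_forall {R : Multiset ℕ → Multiset ℕ → Prop} (hR : FullyInvariant R)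
    {D : Set (Multiset ℕ)} (h : ∀ a ∈ D, ∀ b, R a b → b ∈ D) : R ≤ SameSide D :=
  fun a b hab => ⟨fun ha => h a ha b hab, fun hb => h b hb a (hR.symm hab)⟩

theorem balancedRel_le_sameSide_singleton {w : Multiset ℕ} (hw : w.Nodup ∨ w.card < 3) :
    BalancedRel ≤ SameSide {w} := by
  refine le_sameSide_of_forall fullyInvariant_balancedRel ?_
  rintro _ rfl b (rfl | ⟨h, h'⟩)
  · rfl
  · rcases hw with hw | hw
    exacts [absurd hw h.1, absurd hw (by omega)]

theorem balancedRel_le_sameSide_cube (x : ℕ) : BalancedRel ≤ SameSide {3 • {x}} := by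
  refine le_sameSide_of_forall fullyInvariant_balancedRel ?_
  rintro _ rfl b (rfl | ⟨-, ⟨-, hb, h⟩ | ⟨h, -⟩⟩)
  · rfl
  · rw [Set.mem_singleton_iff, nsmul_singleton, eq_replicate]
    exact ⟨hb, fun j hj => by simpa using (h j).2 hj⟩
  · simp at h

theorem balancedRel_le_sameSide_squareMulPair {x y : ℕ} (hxy : x ≠ y) :
    BalancedRel ≤ SameSide (squareMulPair x y) := by
  refine le_sameSide_of_forall fullyInvariant_balancedRel fun a ha b hab => ?_
  have hmem : ∀ j, j ∈ a ↔ j = x ∨ j = y := by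
    rcases ha with rfl | rfl <;> intro j <;> simp
  have hcard : a.card = 3 := by rcases ha with rfl | rfl <;> simp
  rcases hab with rfl | ⟨⟨-, hb⟩, ⟨-, hb3, h⟩ | ⟨h, -⟩⟩
  · exact ha
  · obtain ⟨z, hz⟩ := exists_two_le_count hb
    obtain ⟨r, rfl⟩ := Multiset.le_iff_exists_add.1
      (show 2 • {z} ≤ b by rw [nsmul_singleton]; exact le_count_iff_replicate_le.1 hz)
    obtain ⟨v, rfl⟩ := card_eq_one.1 (show r.card = 1 by
      rw [card_add, card_nsmul, card_singleton] at hb3; omega)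
    have hx := (h x).1 ((hmem x).2 (Or.inl rfl))
    have hy := (h y).1 ((hmem y).2 (Or.inr rfl))
    simp only [mem_add, mem_nsmul, mem_singleton] at hx hy
    have hcase : (z = x ∧ v = y) ∨ (z = y ∧ v = x) := by omega
    rcases hcase with ⟨rfl, rfl⟩ | ⟨rfl, rfl⟩
    · exact Or.inl rfl
    · exact Or.inr (add_comm _ _)
  · omega

theorem letters_xxy : letters w_xxy = 2 • {0} + {1} := by
  simp only [w_xxy, xw, yw, letters_mul, letters_of]; module

theorem letters_xyy : letters w_xyy = {0} + 2 • {1} := by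
  simp only [w_xyy, xw, yw, letters_mul, letters_of]; module

theorem letters_spow (n : ℕ) : letters (spow xw n) = (n + 1) • {0} := by
  induction n with
  | zero => simp [spow, xw]
  | succ n ih => simp only [spow, xw, letters_mul, letters_of] at ih ⊢; rw [ih]; module

theorem letters_commId : letters commId.1 = letters commId.2 := by
  simp only [commId, letters_mul]; exact add_comm _ _

theorem le_COMcom (V : ComVariety) : V ≤ COMcom :=
  (eqTh_mono (Set.singleton_subset_iff.2 V.2)).trans V.1.closed.le

theorem Tcom_le (V : ComVariety) : Tcom ≤ V := fun _ _ => subset_eqTh _ (Set.mem_univ _)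

/-- The variety satisfies `x²y = xⁿ⁺²y` for some `n ≥ 1`. -/
def SatPeriodicLaw (V : ComVariety) : Prop :=
  ∃ n : ℕ, 1 ≤ n ∧ WordAbsorbs (wordRel V) (2 • {0} + {1}) (n • {0})

theorem idQ_mem_iff {V : ComVariety} :
    idQ ∈ V.1.th ↔ wordRel V (2 • {0} + {1}) ({0} + 2 • {1}) := by
  rw [← letters_xxy, ← letters_xyy, wordRel_letters_iff]; rfl

theorem isCodistributive_of_test {V : ComVariety}
    {Test : (Multiset ℕ → Multiset ℕ → Prop) → Prop} (hprime : ∀ {E}, Test E → PrimeRel E)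
    (hdet : ∀ W ≤ V, ∀ s t, s ≠ 0 → t ≠ 0 →
      (∀ E, Test E → wordRel W ≤ E → E s t) → wordRel W s t) : IsCodistributive V := by
  intro Y Z
  refine le_antisymm (le_of_wordRel fun s t hs ht hst => ?_) le_inf_sup
  refine hdet _ inf_le_left s t hs ht fun E hE hle => ?_
  have hV : wordRel V ≤ E := (le_iff_wordRel.1 inf_le_left).trans hle
  have hYZ : wordRel Y ⊓ wordRel Z ≤ E :=
    (wordRel_sup Y Z).symm.le.trans ((le_iff_wordRel.1 inf_le_right).trans hle)
  rw [wordRel_sup] at hst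
  rcases (hprime hE).prime (fullyInvariant_wordRel Y) (fullyInvariant_wordRel Z) hYZ with h | h
  · exact wordRel_inf_le (hprime hE).equivalence hV h _ _ hst.1
  · exact wordRel_inf_le (hprime hE).equivalence hV h _ _ hst.2

theorem SatPeriodicLaw.isCodistributive {V : ComVariety} (h : SatPeriodicLaw V) :
    IsCodistributive V := by
  refine isCodistributive_of_test PeriodicTest.primeRel fun W hW s t hs ht hE => ?_
  obtain ⟨n, h1, hn⟩ := h
  exact (fullyInvariant_wordRel W).rel_of_periodicTest
    ⟨n, h1, le_iff_wordRel.1 hW _ _ hn⟩ hs ht hE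

theorem isCodistributive_of_idQ_mem {V : ComVariety} (h : idQ ∈ V.1.th) :
    IsCodistributive V := by
  refine isCodistributive_of_test BalancedTest.primeRel fun W hW s t hs ht hE => ?_
  exact (fullyInvariant_wordRel W).rel_of_balancedTest (idQ_mem_iff.1 (hW h)) hs ht hE

theorem isCodistributive_COMcom : IsCodistributive COMcom := fun Y Z => by
  rw [inf_eq_right.2 (le_COMcom _), inf_eq_right.2 (le_COMcom _), inf_eq_right.2 (le_COMcom _)]

theorem IsCodistributive.isUpperModular {V : ComVariety} (h : IsCodistributive V) :
    IsUpperModular V := fun Y Z hY => by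
  rw [h Y Z, inf_eq_right.2 hY]

section SpecialVarieties

theorem absorbs_SLcom {s : Multiset ℕ} {i : ℕ} (hi : i ∈ s) :
    WordAbsorbs (wordRel SLcom) s {i} := by
  have hR := fullyInvariant_wordRel SLcom
  have hmem : (xw * xw, xw) ∈ SLcom.1.th := subset_eqTh _ (Or.inr rfl)
  have h : WordAbsorbs (wordRel SLcom) {0} {0} := hR.symm (wordRel_letters_iff.2 hmem)
  have h2 := hR.absorbs_bind (fun _ => {i}) (by simp) h
  rw [singleton_bind] at h2
  exact hR.absorbs_mono (singleton_le.2 hi) h2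

theorem absorbs_Ccom_two {s : Multiset ℕ} {i : ℕ} (hi : 2 ≤ s.count i) :
    WordAbsorbs (wordRel (Ccom 2)) s {i} := by
  have hR := fullyInvariant_wordRel (Ccom 2)
  have h : WordAbsorbs (wordRel (Ccom 2)) (2 • {0}) {0} := by
    have hmem : (spow xw 1, spow xw (1 + 1)) ∈ (Ccom 2).1.th := subset_eqTh _ (Or.inr rfl)
    have := wordRel_letters_iff.2 hmem
    rw [letters_spow, letters_spow] at this
    unfold WordAbsorbs
    convert this using 1
    module
  have h2 := hR.absorbs_bind (fun _ => {i}) (by simp) h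
  rw [nsmul_bind', singleton_bind] at h2
  refine hR.absorbs_mono ?_ h2
  rw [nsmul_singleton]
  exact le_count_iff_replicate_le.1 hi

theorem wordRel_SLcom : wordRel SLcom = SameLetters := by
  refine le_antisymm (wordRel_le_of_th_subset subset_rfl fullyInvariant_sameLetters ?_) ?_
  · rintro e (rfl | rfl)
    · rw [letters_commId]; exact SameLetters.equivalence.refl _
    · simp [SameLetters, xw]
  · exact fun a b h => (fullyInvariant_wordRel SLcom).rel_of_sameLetters
      (fun _ => absorbs_SLcom) (fun _ => absorbs_SLcom) h

theorem wordRel_Ccom_two : wordRel (Ccom 2) = SameLinear := by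
  refine le_antisymm (wordRel_le_of_th_subset subset_rfl fullyInvariant_sameLinear ?_) ?_
  · rintro e (rfl | rfl)
    · rw [letters_commId]; exact SameLinear.equivalence.refl _
    · intro i
      simp only [letters_spow, count_nsmul]
      rcases Nat.eq_zero_or_pos (count i {0}) with h | h
      · simp [h]
      · omega
  · refine fun a b h => (fullyInvariant_wordRel _).rel_of_absorbs_square_letters (n := 1)
      (fun i hi => ?_) (fun i hi => ?_) h fun i => Nat.modEq_one
    · rw [one_nsmul]; exact absorbs_Ccom_two hi
    · rw [one_nsmul]; exact absorbs_Ccom_two hi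

/-- The variety of Abelian groups of exponent dividing `n + 1`. -/
def groupCom (n : ℕ) : ComVariety :=
  ⟨varOf {commId, (spow xw n * yw, yw)}, subset_eqTh _ (Set.mem_insert _ _)⟩

theorem absorbs_groupCom (n : ℕ) {p q : Multiset ℕ} (hp : p ≠ 0) (hq : q ≠ 0) :
    WordAbsorbs (wordRel (groupCom n)) q ((n + 1) • p) := by
  have hR := fullyInvariant_wordRel (groupCom n)
  have h : WordAbsorbs (wordRel (groupCom n)) {1} ((n + 1) • {0}) := by
    have hmem : (spow xw n * yw, yw) ∈ (groupCom n).1.th := subset_eqTh _ (Or.inr rfl)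
    have := wordRel_letters_iff.2 hmem
    rw [letters_mul, letters_spow, add_comm] at this
    exact hR.symm this
  have h2 := hR.absorbs_bind (fun j => if j = 0 then p else q)
    (fun j => by split_ifs <;> assumption) h
  simpa [nsmul_bind'] using h2

theorem wordRel_groupCom_le {n q : ℕ} (hq : q ∣ n + 1) :
    wordRel (groupCom n) ≤ CountModEq q := by
  refine wordRel_le_of_th_subset subset_rfl (fullyInvariant_countModEq q) ?_
  rintro e (rfl | rfl)
  · rw [letters_commId]; exact (CountModEq.equivalence q).refl _
  · intro i
    rw [letters_mul, letters_spow, count_add, count_nsmul]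
    simpa using ((Nat.modEq_zero_iff_dvd.2 hq).mul_right (count i {0})).add_right
      (count i (letters yw))

theorem isGroupVariety_of_le_groupCom {G : ComVariety} {n : ℕ} (h : G ≤ groupCom n) :
    IsGroupVariety G.1 := by
  rintro S _ ⟨a⟩ hS
  have hcomm : ∀ b c : S, b * c = c * b := fun b c => by
    simpa [commId, xw, yw] using hS _ G.2 fun i => if i = 0 then b else c
  have hspow : ∀ (σ : ℕ → S) (k : ℕ), FreeSemigroup.lift σ (spow xw k) = spow (σ 0) k := by
    intro σ k
    induction k with
    | zero => simp [spow, xw]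
    | succ k ih => rw [spow, spow, map_mul, ih]; simp [xw]
  have hid : ∀ b c : S, spow b n * c = c := fun b c => by
    simpa [hspow, yw] using hS _ (h (subset_eqTh _ (Or.inr rfl)))
      fun i => if i = 0 then b else c
  have hpow : ∀ b, spow b n = spow a n := fun b => by
    rw [← hid a (spow b n), hcomm, hid]
  refine ⟨spow a n, fun b => ⟨hid a b, by rw [hcomm, hid]⟩, fun b => ?_⟩
  cases n with
  | zero => exact ⟨b, by rw [← hpow b]; exact ⟨hid b b, hid b b⟩⟩
  | succ m => exact ⟨spow b m, hpow b, by rw [hcomm]; exact hpow b⟩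

theorem isPeriodic_of_le_groupCom {G : ComVariety} {n : ℕ} (h : G ≤ groupCom n) :
    IsPeriodic G.1 := by
  refine ⟨0, n, h (wordRel_letters_iff.1 ?_)⟩
  rw [letters_spow, letters_spow]
  have h0 : wordRel (groupCom n) {0} ({0} + (n + 1) • {0}) :=
    absorbs_groupCom n (singleton_ne_zero 0) (singleton_ne_zero 0)
  convert h0 using 1 <;> module

/-- The variety `K` as an element of the lattice of commutative varieties. -/
def Kcom : ComVariety := ⟨Kvar, subset_eqTh _ (Set.mem_union_left _ rfl)⟩

theorem wordRel_Kcom_le : wordRel Kcom ≤ NonlinearRel := by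
  refine wordRel_le_of_th_subset subset_rfl fullyInvariant_nonlinearRel ?_
  rintro e (rfl | rfl | rfl)
  · exact Or.inl letters_commId
  all_goals
    refine Or.inr ?_
    simp only [letters_mul, letters_xxy, letters_of]
    refine ⟨⟨fun h => ?_, by simp⟩, fun h => ?_, by simp⟩ <;>
      simpa [count_nsmul] using nodup_iff_count_le_one.1 h 0

theorem wordRel_Icom_le : wordRel Icom ≤ BalancedRel := by
  refine wordRel_le_of_th_subset subset_rfl fullyInvariant_balancedRel ?_
  rintro e ((rfl | rfl) | rfl | rfl)
  · exact Or.inl letters_commId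
  · refine Or.inr ?_
    simp only [idQ, letters_xxy, letters_xyy]
    refine ⟨⟨fun h => ?_, fun h => ?_⟩, Or.inl ⟨by simp, by simp, fun i => by simp⟩⟩
    · simpa [count_nsmul] using nodup_iff_count_le_one.1 h 0
    · simpa [count_nsmul] using nodup_iff_count_le_one.1 h 1
  all_goals
    refine Or.inr ?_
    simp only [w_xxyz, xw, yw, zw, letters_mul, letters_of]
    refine ⟨⟨fun h => ?_, fun h => ?_⟩, Or.inr (by simp)⟩ <;>
      simpa using nodup_iff_count_le_one.1 h 0

theorem vSatZero_of_zeroPair_subset {V : SgVariety} {w : Word} {k : ℕ} (hk : ¬ occursIn k w)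
    (h : zeroPair w k ⊆ V.th) : VSatZero V w := by
  intro S _ hS σ a
  have hw : FreeSemigroup.lift (Function.update σ k a) w = FreeSemigroup.lift σ w := by
    clear h
    induction w using FreeSemigroup.recOnMul with
    | ih1 i =>
      have : i ≠ k := fun h => hk (Or.inl h.symm)
      simp [this]
    | ih2 i w _ ih =>
      have : i ≠ k := fun h => hk (Or.inl h.symm)
      rw [map_mul, map_mul, ih fun h => hk (Or.inr (by simpa [occursIn] using h))]
      simp [this]
  have h1 := hS _ (h (Or.inl rfl)) (Function.update σ k a)
  have h2 := hS _ (h (Or.inr rfl)) (Function.update σ k a)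
  simp only [map_mul, hw, FreeSemigroup.lift_of, Function.update_self] at h1 h2
  exact ⟨h1, h2⟩

theorem vSatZero_of_le_Kcom {V : ComVariety} (h : V ≤ Kcom) : VSatZero V.1 w_xxy :=
  vSatZero_of_zeroPair_subset (k := 2) (by simp [occursIn, w_xxy, xw, yw])
    ((Set.subset_union_right.trans (subset_eqTh _)).trans h)

theorem vSatZero_of_le_Icom {V : ComVariety} (h : V ≤ Icom) : VSatZero V.1 w_xxyz :=
  vSatZero_of_zeroPair_subset (k := 3) (by simp [occursIn, w_xxyz, xw, yw, zw])
    ((Set.subset_union_right.trans (subset_eqTh _)).trans h)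

theorem idQ_mem_of_le_Icom {V : ComVariety} (h : V ≤ Icom) : idQ ∈ V.1.th :=
  h (subset_eqTh _ (Or.inl (Or.inr rfl)))

end SpecialVarieties

theorem IsGroupVariety.wordRel_cancel {G : ComVariety} (hG : IsGroupVariety G.1)
    {p a b : Multiset ℕ} (hp : p ≠ 0) (ha : a ≠ 0) (hb : b ≠ 0)
    (h : wordRel G (p + a) (p + b)) : wordRel G a b := by
  obtain ⟨u, rfl⟩ := exists_letters_eq hp
  obtain ⟨s, rfl⟩ := exists_letters_eq ha
  obtain ⟨t, rfl⟩ := exists_letters_eq hb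
  rw [← letters_mul, ← letters_mul, wordRel_letters_iff] at h
  refine wordRel_letters_iff.2 (mem_th_iff.2 fun S _ hS σ => ?_)
  obtain ⟨e, he, hinv⟩ := hG S ⟨σ 0⟩ hS
  obtain ⟨c, -, hc⟩ := hinv (FreeSemigroup.lift σ u)
  have hst := congrArg (c * ·) (hS _ h σ)
  simpa only [map_mul, ← mul_assoc, hc, (he _).1] using hst

theorem SatPeriodicLaw.of_sup {G M N : ComVariety} (hG : IsGroupVariety G.1)
    (hper : IsPeriodic G.1) (hM : WordAbsorbs (wordRel M) (2 • {0} + {1}) {0})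
    (hN : VSatZero N.1 w_xxy) : SatPeriodicLaw (G ⊔ M ⊔ N) := by
  obtain ⟨n, k, hper⟩ := hper
  have hR := fullyInvariant_wordRel G
  refine ⟨k + 1, by omega, ?_⟩
  unfold WordAbsorbs
  rw [wordRel_sup, wordRel_sup]
  refine ⟨⟨?_, (fullyInvariant_wordRel M).absorbs_nsmul hM _⟩,
    (fullyInvariant_wordRel N).absorbs_nsmul ?_ _⟩
  · rw [← wordRel_letters_iff, letters_spow, letters_spow] at hper
    have h := hR.add_right (2 • {0} + {1}) hper
    refine hG.wordRel_cancel (p := (n + 1) • {0}) (by simp) (by simp) (by simp) ?_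
    convert h using 1
    module
  · have hmem : (w_xxy, w_xxy * xw) ∈ N.1.th :=
      mem_th_iff.2 fun S _ hS σ => by simpa [xw] using (hN S hS σ (σ 0)).1.symm
    have h := wordRel_letters_iff.2 hmem
    rwa [letters_mul, letters_xxy] at h

theorem wordRel_Tcom (a b : Multiset ℕ) (ha : a ≠ 0) (hb : b ≠ 0) : wordRel Tcom a b := by
  obtain ⟨s, rfl⟩ := exists_letters_eq ha
  obtain ⟨t, rfl⟩ := exists_letters_eq hb
  exact wordRel_letters_iff.2 (subset_eqTh _ (Set.mem_univ _))

theorem absorbs_square_mul_of_eq {M : ComVariety} (h : M = Tcom ∨ M = SLcom ∨ M = Ccom 2) :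
    WordAbsorbs (wordRel M) (2 • {0} + {1}) {0} := by
  rcases h with rfl | rfl | rfl
  · exact wordRel_Tcom _ _ (by simp) (by simp)
  · exact absorbs_SLcom (by simp)
  · exact absorbs_Ccom_two (by simp)

theorem idQ_mem_sup {M N : ComVariety} (hM : M = Tcom ∨ M = SLcom) (hN : idQ ∈ N.1.th) :
    idQ ∈ (M ⊔ N).1.th := by
  refine ⟨idQ_mem_iff.2 ?_, hN⟩
  rcases hM with rfl | rfl
  · exact wordRel_Tcom _ _ (by simp) (by simp)
  · rw [wordRel_SLcom]
    intro i
    simp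

theorem SatPeriodicLaw.exists_sup {V : ComVariety} (h : SatPeriodicLaw V) :
    ∃ G M N : ComVariety, IsGroupVariety G.1 ∧ IsPeriodic G.1 ∧
      (M = Tcom ∨ M = SLcom ∨ M = Ccom 2) ∧ VSatZero N.1 w_xxy ∧ V = G ⊔ M ⊔ N := by
  obtain ⟨n, h1, hn⟩ := h
  obtain ⟨m, rfl⟩ := Nat.exists_eq_add_of_le' h1
  obtain ⟨M, hM, hMV, hlet, hlin⟩ : ∃ M, (M = Tcom ∨ M = SLcom ∨ M = Ccom 2) ∧ M ≤ V ∧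
      (wordRel V ≤ SameLetters → wordRel M ≤ SameLetters) ∧
      (wordRel V ≤ SameLinear → wordRel M ≤ SameLinear) := by
    by_cases hlin : wordRel V ≤ SameLinear
    · refine ⟨Ccom 2, by simp, le_iff_wordRel.2 (wordRel_Ccom_two ▸ hlin), fun _ => ?_,
        fun _ => wordRel_Ccom_two.le⟩
      exact wordRel_Ccom_two.le.trans sameLinear_le_sameLetters
    by_cases hlet : wordRel V ≤ SameLetters
    · exact ⟨SLcom, by simp, le_iff_wordRel.2 (wordRel_SLcom ▸ hlet),
        fun _ => wordRel_SLcom.le, fun h => absurd h hlin⟩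
    · exact ⟨Tcom, by simp, Tcom_le V, fun h => absurd h hlet, fun h => absurd h hlin⟩
  refine ⟨V ⊓ groupCom m, M, V ⊓ Kcom, isGroupVariety_of_le_groupCom inf_le_right,
    isPeriodic_of_le_groupCom inf_le_right, hM, vSatZero_of_le_Kcom inf_le_right,
    le_antisymm (le_of_wordRel fun s t hs ht hst => ?_)
      (sup_le (sup_le inf_le_left hMV) inf_le_left)⟩
  rw [wordRel_sup, wordRel_sup] at hst
  obtain ⟨⟨hG, hM⟩, hN⟩ := hst
  refine (fullyInvariant_wordRel V).rel_of_periodicTest ⟨_, h1, hn⟩ hs ht fun E hE hVE => ?_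
  have hEq := hE.primeRel.equivalence
  cases hE with
  | @countModEq p hp k =>
    have hdvd : p ^ k ∣ m + 1 := by
      have h0 := hVE _ _ hn 0
      simpa using (Nat.modEq_iff_dvd' (by simp)).1 h0
    exact wordRel_inf_le hEq hVE (wordRel_groupCom_le hdvd) _ _ hG
  | sameLetters => exact hlet hVE _ _ hM
  | sameLinear => exact hlin hVE _ _ hM
  | nodup hw h0 =>
    exact wordRel_inf_le hEq hVE
      (wordRel_Kcom_le.trans (nonlinearRel_le_sameSide (Or.inl hw))) _ _ hN
  | square x =>
    exact wordRel_inf_le hEq hVE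
      (wordRel_Kcom_le.trans (nonlinearRel_le_sameSide (Or.inr (by simp)))) _ _ hN

theorem exists_sup_of_idQ_mem {V : ComVariety} (h : idQ ∈ V.1.th) :
    ∃ M N : ComVariety, (M = Tcom ∨ M = SLcom) ∧
      VSatZero N.1 w_xxyz ∧ idQ ∈ N.1.th ∧ V = M ⊔ N := by
  obtain ⟨M, hM, hMV, hlet⟩ : ∃ M, (M = Tcom ∨ M = SLcom) ∧ M ≤ V ∧
      (wordRel V ≤ SameLetters → wordRel M ≤ SameLetters) := by
    by_cases hlet : wordRel V ≤ SameLetters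
    · exact ⟨SLcom, by simp, le_iff_wordRel.2 (wordRel_SLcom ▸ hlet), fun _ => wordRel_SLcom.le⟩
    · exact ⟨Tcom, by simp, Tcom_le V, fun h => absurd h hlet⟩
  refine ⟨M, V ⊓ Icom, hM, vSatZero_of_le_Icom inf_le_right, idQ_mem_of_le_Icom inf_le_right,
    le_antisymm (le_of_wordRel fun s t hs ht hst => ?_) (sup_le hMV inf_le_left)⟩
  rw [wordRel_sup] at hst
  obtain ⟨hM, hN⟩ := hst
  refine (fullyInvariant_wordRel V).rel_of_balancedTest (idQ_mem_iff.1 h) hs ht fun E hE hVE => ?_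
  have hEq := hE.primeRel.equivalence
  cases hE with
  | sameLetters => exact hlet hVE _ _ hM
  | nodup hw h0 =>
    exact wordRel_inf_le hEq hVE
      (wordRel_Icom_le.trans (balancedRel_le_sameSide_singleton (Or.inl hw))) _ _ hN
  | square x =>
    exact wordRel_inf_le hEq hVE
      (wordRel_Icom_le.trans (balancedRel_le_sameSide_singleton (Or.inr (by simp)))) _ _ hN
  | cube x =>
    exact wordRel_inf_le hEq hVE (wordRel_Icom_le.trans (balancedRel_le_sameSide_cube x)) _ _ hN
  | squareMul hxy =>
    exact wordRel_inf_le hEq hVE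
      (wordRel_Icom_le.trans (balancedRel_le_sameSide_squareMulPair hxy)) _ _ hN

theorem exists_wordRel_ne {V : ComVariety} (hV : V ≠ COMcom) : ∃ a b, wordRel V a b ∧ a ≠ b := by
  by_contra! hcon
  refine hV (le_antisymm (le_COMcom V) (le_of_wordRel fun a b _ _ hab => ?_))
  rw [hcon a b hab]
  exact (fullyInvariant_wordRel _).refl b

theorem absorbs_inf_groupCom {V : ComVariety} {T n x : ℕ}
    (h : WordAbsorbs (wordRel V) (T • {x}) (n • {x})) {s : Multiset ℕ} (hs : s ≠ 0) :
    WordAbsorbs (wordRel (V ⊓ groupCom n)) s {x} := by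
  have hR := fullyInvariant_wordRel (V ⊓ groupCom n)
  have hZ : WordAbsorbs (wordRel (V ⊓ groupCom n)) s ((n + 1) • {x}) :=
    le_iff_wordRel.1 inf_le_right _ _ (absorbs_groupCom n (singleton_ne_zero x) hs)
  have hn : WordAbsorbs (wordRel (V ⊓ groupCom n)) s (n • {x}) := by
    refine hR.absorbs_chain (hR.absorbs_nsmul hZ T) (b := T • ({x} : Multiset ℕ)) ?_
      (le_iff_wordRel.1 inf_le_left _ _ h)
    refine le_add_of_le_right ?_
    rw [succ_nsmul, nsmul_add]
    exact le_add_left le_rfl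
  rw [succ_nsmul] at hZ
  exact hR.absorbs_cancel hZ hn

theorem IsUpperModular.satPeriodicLaw_or_idQ_mem {V : ComVariety} (h : IsUpperModular V)
    (hV : V ≠ COMcom) : SatPeriodicLaw V ∨ idQ ∈ V.1.th := by
  by_contra! hcon
  obtain ⟨hper, hq⟩ := hcon
  have hRV := fullyInvariant_wordRel V
  have hpair : wordRel V ≤ SameSide (squareMulPair 0 1) := by
    by_contra hcon
    exact hper (hRV.exists_absorbs_of_not_sameSide_squareMulPair zero_ne_one hcon)
  have hne : ({0} + 2 • {1} : Multiset ℕ) ≠ 2 • {0} + {1} := fun heq => by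
    simpa [count_nsmul] using congrArg (count 0) heq
  have hside : wordRel V ≤ SameSide {2 • {0} + {1}} := by
    refine le_sameSide_of_forall hRV ?_
    rintro _ rfl b hb
    rcases (hpair _ _ hb).1 (Or.inl rfl) with rfl | rfl
    · rfl
    · exact absurd (idQ_mem_iff.2 hb) hq
  obtain ⟨a, b, hab, hab'⟩ := exists_wordRel_ne hV
  obtain ⟨T, n, hn, hT⟩ := hRV.exists_period hab hab' (singleton_ne_zero 0)
  have hT1 : WordAbsorbs (wordRel V) (T • {1}) (n • {1}) := by
    have := hRV.absorbs_bind (fun _ => {1}) (by simp) hT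
    rwa [nsmul_bind', nsmul_bind', singleton_bind] at this
  have hum := h (V ⊓ Icom) (groupCom n) inf_le_left
  have hleft : wordRel (V ⊓ (V ⊓ Icom ⊔ groupCom n)) ≤ SameSide {2 • {0} + {1}} := by
    have hequiv : Equivalence (SameSide ({2 • {0} + {1}} : Set (Multiset ℕ))) :=
      SameSide.equivalence _
    refine wordRel_inf_le hequiv hside (le_sameSide_of_forall (fullyInvariant_wordRel _) ?_)
    rintro _ rfl b hb
    rw [wordRel_sup] at hb
    have hY := wordRel_inf_le (SameSide.equivalence _) hpair
      (wordRel_Icom_le.trans (balancedRel_le_sameSide_squareMulPair zero_ne_one)) _ _ hb.1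
    rcases hY.1 (Or.inl rfl) with rfl | rfl
    · rfl
    · have h0 := wordRel_groupCom_le dvd_rfl _ _ hb.2 0
      have h1 := (Nat.modEq_iff_dvd' (by simp)).1 h0.symm
      simp at h1
      omega
  rw [hum, wordRel_sup] at hleft
  have hR := fullyInvariant_wordRel (V ⊓ groupCom n)
  have hrel : wordRel (V ⊓ groupCom n) (2 • {0} + {1}) ({0} + 2 • {1}) := by
    have hx : wordRel (V ⊓ groupCom n) ({0} + 2 • {1}) ({0} + 2 • {1} + {0}) :=
      absorbs_inf_groupCom hT (by simp)
    have hy : wordRel (V ⊓ groupCom n) (2 • {0} + {1}) (2 • {0} + {1} + {1}) :=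
      absorbs_inf_groupCom hT1 (by simp)
    refine hR.trans hy (hR.symm ?_)
    convert hx using 1
    module
  exact hne ((hleft _ _ ⟨idQ_mem_iff.1 (idQ_mem_of_le_Icom inf_le_right), hrel⟩).1 rfl)

/-- Theorem 1 of the paper.  For a commutative semigroup
variety `V`: (a) `V` is upper-modular in **Com** ⟺ (b) `V` is codistributive in
**Com** ⟺ (c) `V = COM`, or `V = M ∨ N` with `M ∈ {T, SL}` and `N` a commutative
variety satisfying `x²yz = 0` and `x²y = xy²`, or `V = G ∨ M ∨ N` with `G` an
Abelian (i.e. commutative) periodic group variety, `M ∈ {T, SL, C₂}` and `N` a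
commutative variety satisfying `x²y = 0`. -/
theorem upperModular_iff_codistributive_iff (V : ComVariety) :
    (IsUpperModular V ↔ IsCodistributive V) ∧
    (IsCodistributive V ↔
      (V = COMcom ∨
        (∃ M N : ComVariety, (M = Tcom ∨ M = SLcom) ∧
          VSatZero N.1 w_xxyz ∧ idQ ∈ N.1.th ∧ V = M ⊔ N) ∨
        (∃ G M N : ComVariety, IsGroupVariety G.1 ∧ IsPeriodic G.1 ∧
          (M = Tcom ∨ M = SLcom ∨ M = Ccom 2) ∧
          VSatZero N.1 w_xxy ∧ V = G ⊔ M ⊔ N))) := by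
  refine ⟨⟨fun h => ?_, IsCodistributive.isUpperModular⟩, fun h => ?_, ?_⟩
  · by_cases hV : V = COMcom
    · exact hV ▸ isCodistributive_COMcom
    · exact (h.satPeriodicLaw_or_idQ_mem hV).elim SatPeriodicLaw.isCodistributive
        isCodistributive_of_idQ_mem
  · by_cases hV : V = COMcom
    · exact Or.inl hV
    · exact Or.inr ((h.isUpperModular.satPeriodicLaw_or_idQ_mem hV).symm.imp
        exists_sup_of_idQ_mem SatPeriodicLaw.exists_sup)
  · rintro (rfl | ⟨M, N, hM, -, hN, rfl⟩ | ⟨G, M, N, hG, hper, hM, hN, rfl⟩)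
    · exact isCodistributive_COMcom
    · exact isCodistributive_of_idQ_mem (idQ_mem_sup hM hN)
    · exact (SatPeriodicLaw.of_sup hG hper (absorbs_square_mul_of_eq hM) hN).isCodistributive
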